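/- arXiv:2003.11508 — 4 statements merged into one kernel-verified Lean document; each statement's English description precedes it below -/
import Mathlib

section
/- Let n be even and let P ∈ ℝ[x] be a polynomial of degree n with P(x) = P(−x). Let V be a simple 𝒜(P)-module which is the direct sum of one-dimensional h-eigenspaces, with set of h-eigenvalues Λ (an arithmetic progression with difference 2, as in the classification of simple modules containing an h-eigenvector). Let Λ' = Λ \ {min Λ} if Λ has a smallest element, and Λ' = Λ otherwise. Then there exists a positive definite Hermitian form (·,·) on V satisfying (hu,v) = (u,hv), (eu,v) = −(u,fv) and (fu,v) = −(u,ev) for all u,v ∈ V if and only if Λ ⊂ ℝ and P(λ − 1) < 0 for every λ ∈ Λ'. -/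
open Polynomial
open scoped Classical

noncomputable section

abbrev FA : Type := FreeAlgebra ℂ (Fin 3)

def Egen : FA := FreeAlgebra.ι ℂ 0
def Fgen : FA := FreeAlgebra.ι ℂ 1
def Hgen : FA := FreeAlgebra.ι ℂ 2

/-- The defining relations of the deformation `𝒜(P)` of the type A Kleinian singularity:
`he − eh = 2e`, `hf − fh = −2f`, `ef = P(h−1)`, `fe = P(h+1)`. -/
inductive ARel (P : ℂ[X]) : FA → FA → Prop
  | he : ARel P (Hgen * Egen - Egen * Hgen) (2 * Egen)
  | hf : ARel P (Hgen * Fgen - Fgen * Hgen) (-(2 * Fgen))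
  | ef : ARel P (Egen * Fgen) (Polynomial.aeval (Hgen - 1) P)
  | fe : ARel P (Fgen * Egen) (Polynomial.aeval (Hgen + 1) P)

/-- The algebra `𝒜(P)`. -/
abbrev AP (P : ℂ[X]) : Type := RingQuot (ARel P)

def eA (P : ℂ[X]) : AP P := RingQuot.mkAlgHom ℂ (ARel P) Egen
def fA (P : ℂ[X]) : AP P := RingQuot.mkAlgHom ℂ (ARel P) Fgen
def hA (P : ℂ[X]) : AP P := RingQuot.mkAlgHom ℂ (ARel P) Hgen

/-- `P` is real on the imaginary axis: `P(it) ∈ ℝ` for all real `t`. -/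
def RealOnIm (P : ℂ[X]) : Prop := ∀ t : ℝ, ∃ r : ℝ, P.eval (Complex.I * t) = r

/-- An invariant Hermitian (sesquilinear) form on the regular bimodule `𝒜(P)`. -/
structure InvForm (P : ℂ[X]) where
  B : AP P → AP P → ℂ
  add_left : ∀ u v w, B (u + v) w = B u w + B v w
  smul_left : ∀ (c : ℂ) (u v), B (c • u) v = c * B u v
  conj_symm : ∀ u v, B u v = starRingEnd ℂ (B v u)
  e_left : ∀ u v, B (eA P * u) v = - B u (v * fA P)
  h_left : ∀ u v, B (hA P * u) v = - B u (v * hA P)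
  f_left : ∀ u v, B (fA P * u) v = - B u (v * eA P)
  e_right : ∀ u v, B (u * eA P) v = - B u (fA P * v)
  h_right : ∀ u v, B (u * hA P) v = - B u (hA P * v)
  f_right : ∀ u v, B (u * fA P) v = - B u (eA P * v)

/-- The regular bimodule `𝒜(P)` is unitarizable: there is a positive definite
invariant Hermitian form on it. -/
def Unitarizable (P : ℂ[X]) : Prop :=
  ∃ Φ : InvForm P, ∀ u : AP P, u ≠ 0 → ∃ r : ℝ, 0 < r ∧ Φ.B u u = r


/-- A module over `𝒜(P)`, together with a compatible `ℂ`-vector space structure. -/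
structure APMod (P : ℂ[X]) where
  V : Type
  [ag : AddCommGroup V]
  [mc : Module ℂ V]
  [mp : Module (AP P) V]
  [st : IsScalarTower ℂ (AP P) V]
  [sc : SMulCommClass ℂ (AP P) V]

attribute [instance] APMod.ag APMod.mc APMod.mp APMod.st APMod.sc

/-- The `h`-eigenspace of `M` with eigenvalue `μ`: `{v | h • v = μ • v}`. -/
def eigSpace {P : ℂ[X]} (M : APMod P) (μ : ℂ) : Submodule ℂ M.V where
  carrier := {v | hA P • v = μ • v}
  add_mem' := by
    intro u v hu hv
    have hu' : hA P • u = μ • u := hu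
    have hv' : hA P • v = μ • v := hv
    show hA P • (u + v) = μ • (u + v)
    rw [smul_add, smul_add, hu', hv']
  zero_mem' := by
    show hA P • (0 : M.V) = μ • (0 : M.V)
    rw [smul_zero, smul_zero]
  smul_mem' := by
    intro c v hv
    have hv' : hA P • v = μ • v := hv
    show hA P • (c • v) = μ • (c • v)
    rw [← smul_comm c (hA P) v, hv']
    exact smul_comm c μ v

/-- The set of `h`-eigenvalues of `M`. -/
def spec {P : ℂ[X]} (M : APMod P) : Set ℂ := {μ : ℂ | eigSpace M μ ≠ ⊥}

section InternalProjection

variable {ι : Type*} {V : Type*} [AddCommGroup V] [Module ℂ V] {A : ι → Submodule ℂ V}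

/-- The projection of `V` onto the summand `A i` of an internal direct sum. -/
def internalProj (hA : DirectSum.IsInternal A) (i : ι) : V →ₗ[ℂ] V :=
  (A i).subtype ∘ₗ DirectSum.component ℂ ι (fun i => A i) i ∘ₗ
    (LinearEquiv.ofBijective (DirectSum.coeLinearMap A) hA).symm.toLinearMap

variable (hA : DirectSum.IsInternal A)

lemma internalProj_mem (i : ι) (u : V) : internalProj hA i u ∈ A i := Subtype.property _

lemma internalProj_coe (i : ι) (x : DirectSum ι fun i => A i) :
    internalProj hA i (DirectSum.coeLinearMap A x) = x i := by
  have h : (LinearEquiv.ofBijective (DirectSum.coeLinearMap A) hA).symm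
      (DirectSum.coeLinearMap A x) = x :=
    (LinearEquiv.ofBijective (DirectSum.coeLinearMap A) hA).symm_apply_apply x
  simp only [internalProj, LinearMap.comp_apply, LinearEquiv.coe_coe, h]
  rfl

lemma internalProj_of_mem {i : ι} {u : V} (hu : u ∈ A i) (j : ι) :
    internalProj hA j u = if i = j then u else 0 := by
  have h : u = DirectSum.coeLinearMap A (DirectSum.lof ℂ ι (fun i => A i) i ⟨u, hu⟩) := by
    simp
  conv_lhs => rw [h]
  rw [internalProj_coe, DirectSum.lof_eq_of]
  split_ifs with hij
  · subst hij
    rw [DirectSum.of_eq_same]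
  · rw [DirectSum.of_eq_of_ne _ _ _ (Ne.symm hij)]
    rfl

lemma finite_support_internalProj (u : V) : {i | internalProj hA i u ≠ 0}.Finite := by
  obtain ⟨x, rfl⟩ := hA.2 u
  refine (DFinsupp.finite_support x).subset fun i hi hx => hi ?_
  have := internalProj_coe hA i x
  rw [hx] at this
  exact this

lemma eq_zero_of_internalProj_eq_zero {u : V} (h : ∀ i, internalProj hA i u = 0) : u = 0 := by
  obtain ⟨x, rfl⟩ := hA.2 u
  have hx : x = 0 := by
    ext i
    exact (internalProj_coe hA i x).symm.trans (h i)
  subst hx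
  exact map_zero _

/-- A linear map permuting the summands along `σ` intertwines the projections. -/
lemma internalProj_map (T : V →ₗ[ℂ] V) {σ : ι → ι} (hσ : Function.Injective σ)
    (hT : ∀ i, ∀ u ∈ A i, T u ∈ A (σ i)) (i : ι) (u : V) :
    internalProj hA (σ i) (T u) = T (internalProj hA i u) := by
  have hu : u ∈ ⨆ i, A i := hA.submodule_iSup_eq_top ▸ Submodule.mem_top
  induction hu using Submodule.iSup_induction' with
  | mem j u hu =>
    rw [internalProj_of_mem hA (hT j u hu), internalProj_of_mem hA hu]
    simp only [hσ.eq_iff]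
    split_ifs <;> simp
  | zero => simp
  | add u v _ _ hu hv => simp [hu, hv]

end InternalProjection

/-- A multiplicative cocycle on `ℤ` with positive values is a coboundary. -/
lemma exists_pos_int_weight (G : ℤ → ℝ) (hG : ∀ k, 0 < G k) :
    ∃ W : ℤ → ℝ, (∀ k, 0 < W k) ∧ ∀ k, W (k + 1) = G k * W k := by
  refine ⟨fun k => (∏ i ∈ Finset.Ico 0 k, G i) / ∏ i ∈ Finset.Ico k 0, G i,
    fun k => div_pos (Finset.prod_pos fun i _ => hG i) (Finset.prod_pos fun i _ => hG i),
    fun k => ?_⟩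
  beta_reduce
  rcases le_or_gt 0 k with hk | hk
  · have h : Finset.Ico 0 (k + 1) = insert k (Finset.Ico 0 k) := by
      ext i; simp only [Finset.mem_Ico, Finset.mem_insert]; omega
    rw [h, Finset.prod_insert (by simp), Finset.Ico_eq_empty (by omega : ¬ k + 1 < 0),
      Finset.Ico_eq_empty (by omega : ¬ k < 0)]
    simp
  · have h : Finset.Ico k 0 = insert k (Finset.Ico (k + 1) 0) := by
      ext i; simp only [Finset.mem_Ico, Finset.mem_insert]; omega
    rw [h, Finset.prod_insert (by simp), Finset.Ico_eq_empty (by omega : ¬ 0 < k + 1),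
      Finset.Ico_eq_empty (by omega : ¬ 0 < k)]
    have := (hG k).ne'
    field_simp

lemma exists_pos_weight (g : ℂ → ℝ) (hg : ∀ μ, 0 < g μ) :
    ∃ w : ℂ → ℝ, (∀ μ, 0 < w μ) ∧ ∀ μ, w (μ + 2) = g μ * w μ := by
  choose W hW hW' using fun r : ℂ =>
    exists_pos_int_weight (fun k => g (r + 2 * k)) fun k => hg _
  refine ⟨fun μ => W (μ - 2 * ⌊μ.re / 2⌋) ⌊μ.re / 2⌋, fun μ => hW _ _, fun μ => ?_⟩
  have hfl : ⌊(μ + 2).re / 2⌋ = ⌊μ.re / 2⌋ + 1 := by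
    rw [← Int.floor_add_one]
    congr 1
    simp [add_div]
  have hr : μ + 2 - 2 * ((⌊μ.re / 2⌋ + 1 : ℤ) : ℂ) = μ - 2 * ⌊μ.re / 2⌋ := by
    push_cast
    ring
  simp only [hfl, hr, hW', sub_add_cancel]

section Relations

variable (P : ℂ[X])

lemma hA_mul_eA : hA P * eA P = eA P * hA P + 2 * eA P := by
  have := RingQuot.mkAlgHom_rel ℂ (ARel.he (P := P))
  rw [map_sub, map_mul, map_mul, map_mul, map_ofNat, sub_eq_iff_eq_add'] at this
  exact this

lemma hA_mul_fA : hA P * fA P = fA P * hA P - 2 * fA P := by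
  have := RingQuot.mkAlgHom_rel ℂ (ARel.hf (P := P))
  rw [map_sub, map_neg, map_mul, map_mul, map_mul, map_ofNat, sub_eq_iff_eq_add',
    ← sub_eq_add_neg] at this
  exact this

lemma fA_mul_eA : fA P * eA P = aeval (hA P + 1) P := by
  have := RingQuot.mkAlgHom_rel ℂ (ARel.fe (P := P))
  rw [map_mul, ← Polynomial.aeval_algHom_apply, map_add, map_one] at this
  exact this

end Relations

section Module

variable {P : ℂ[X]} (M : APMod P)

/-- The action of `a : 𝒜(P)` as a `ℂ`-linear endomorphism. -/
def actLin (a : AP P) : M.V →ₗ[ℂ] M.V where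
  toFun u := a • u
  map_add' := smul_add a
  map_smul' c u := (smul_comm c a u).symm

variable {M}

lemma mem_eigSpace {μ : ℂ} {u : M.V} : u ∈ eigSpace M μ ↔ hA P • u = μ • u := Iff.rfl

lemma hA_smul_mem {μ : ℂ} {u : M.V} (hu : u ∈ eigSpace M μ) : hA P • u ∈ eigSpace M μ := by
  rw [mem_eigSpace.1 hu]
  exact Submodule.smul_mem _ μ hu

lemma ofNat_two_smul (a : AP P) (u : M.V) : (2 * a) • u = (2 : ℂ) • a • u := by
  rw [two_mul, add_smul, two_smul]

lemma eA_smul_mem {μ : ℂ} {u : M.V} (hu : u ∈ eigSpace M μ) :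
    eA P • u ∈ eigSpace M (μ + 2) := by
  rw [mem_eigSpace] at hu ⊢
  rw [← mul_smul, hA_mul_eA, add_smul, ofNat_two_smul, mul_smul, hu, add_smul,
    smul_comm]

lemma fA_smul_mem {μ : ℂ} {u : M.V} (hu : u ∈ eigSpace M μ) :
    fA P • u ∈ eigSpace M (μ - 2) := by
  rw [mem_eigSpace] at hu ⊢
  rw [← mul_smul, hA_mul_fA, sub_smul, ofNat_two_smul, mul_smul, hu, sub_smul,
    smul_comm]

lemma aeval_smul_of_smul_eq {a : AP P} {c : ℂ} {u : M.V} (h : a • u = c • u) (Q : ℂ[X]) :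
    aeval a Q • u = Q.eval c • u := by
  induction Q using Polynomial.induction_on' with
  | add p q hp hq => simp [add_smul, hp, hq]
  | monomial k r =>
    have hk : a ^ k • u = c ^ k • u := by
      induction k with
      | zero => simp
      | succ k ih => rw [pow_succ, mul_smul, h, ← smul_comm, ih, smul_smul, ← pow_succ']
    rw [aeval_monomial, eval_monomial, ← Algebra.smul_def, smul_assoc, hk, smul_smul]

lemma fA_smul_eA_smul {μ : ℂ} {u : M.V} (hu : u ∈ eigSpace M μ) :
    fA P • eA P • u = P.eval (μ + 1) • u := by
  rw [← mul_smul, fA_mul_eA]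
  refine aeval_smul_of_smul_eq ?_ P
  rw [add_smul, add_smul, mem_eigSpace.1 hu, one_smul, one_smul]

/-- A complex subspace stable under `e`, `f` and `h` is an `𝒜(P)`-submodule. -/
lemma smul_mem_of_generators_stable (W : Submodule ℂ M.V) (he : ∀ u ∈ W, eA P • u ∈ W)
    (hf : ∀ u ∈ W, fA P • u ∈ W) (hh : ∀ u ∈ W, hA P • u ∈ W) (a : AP P) :
    ∀ u ∈ W, a • u ∈ W := by
  obtain ⟨x, rfl⟩ := RingQuot.mkAlgHom_surjective ℂ (ARel P) a
  induction x using FreeAlgebra.induction with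
  | grade0 r =>
    intro u hu
    rw [AlgHom.commutes, Algebra.algebraMap_eq_smul_one, smul_assoc, one_smul]
    exact W.smul_mem r hu
  | grade1 i =>
    fin_cases i
    exacts [he, hf, hh]
  | mul a b iha ihb =>
    intro u hu
    rw [map_mul, mul_smul]
    exact iha _ (ihb u hu)
  | add a b iha ihb =>
    intro u hu
    rw [map_add, add_smul]
    exact W.add_mem (iha u hu) (ihb u hu)

lemma exists_ne_zero_of_mem_spec {μ : ℂ} (hμ : μ ∈ spec M) : ∃ u ∈ eigSpace M μ, u ≠ 0 :=
  (Submodule.ne_bot_iff _).1 hμ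

lemma mem_spec_of_ne_zero {μ : ℂ} {u : M.V} (hu : u ∈ eigSpace M μ) (h0 : u ≠ 0) :
    μ ∈ spec M :=
  (Submodule.ne_bot_iff _).2 ⟨u, hu, h0⟩

lemma exists_smul_eq (hone : ∀ μ ∈ spec M, Module.finrank ℂ (eigSpace M μ) = 1) {μ : ℂ}
    {u v : M.V} (hu : u ∈ eigSpace M μ) (h0 : u ≠ 0) (hv : v ∈ eigSpace M μ) :
    ∃ c : ℂ, c • u = v := by
  have h0' : (⟨u, hu⟩ : eigSpace M μ) ≠ 0 := fun h => h0 (congrArg Subtype.val h)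
  obtain ⟨c, hc⟩ := (finrank_eq_one_iff_of_nonzero' _ h0').1
    (hone μ (mem_spec_of_ne_zero hu h0)) ⟨v, hv⟩
  exact ⟨c, congrArg Subtype.val hc⟩

lemma eA_smul_ne_zero (hsimple : IsSimpleModule (AP P) M.V)
    (hint : DirectSum.IsInternal (fun μ : ℂ => eigSpace M μ))
    (hone : ∀ μ ∈ spec M, Module.finrank ℂ (eigSpace M μ) = 1) {μ : ℂ} {u : M.V}
    (hu : u ∈ eigSpace M μ) (h0 : u ≠ 0) (hμ : μ + 2 ∈ spec M) : eA P • u ≠ 0 := by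
  intro he
  let S : Set ℂ := {ν | ∃ k : ℕ, ν = μ - 2 * k}
  let W : Submodule ℂ M.V := ⨅ ν ∈ Sᶜ, LinearMap.ker (internalProj hint ν)
  have hW : ∀ v, v ∈ W ↔ ∀ ν ∉ S, internalProj hint ν v = 0 := by
    simp [W, Submodule.mem_iInf]
  have hWe : ∀ v ∈ W, eA P • v ∈ W := by
    intro v hv
    rw [hW] at hv ⊢
    intro ν hν
    have h := internalProj_map hint (actLin M (eA P)) (σ := (· + 2)) (add_left_injective 2)
      (fun _ _ => eA_smul_mem) (ν - 2) v
    simp only [sub_add_cancel] at h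
    refine h.trans ?_
    by_cases hS : ν - 2 ∈ S
    · obtain ⟨k, hk⟩ := hS
      rcases k with _ | k
      · have hk' : ν - 2 = μ := by simpa using hk
        obtain ⟨c, hc⟩ := exists_smul_eq hone hu h0 (internalProj_mem hint μ v)
        rw [hk', ← hc, map_smul]
        show c • eA P • u = 0
        rw [he, smul_zero]
      · refine absurd ⟨k, ?_⟩ hν
        push_cast at hk
        linear_combination hk
    · rw [hv _ hS, map_zero]
  have hWf : ∀ v ∈ W, fA P • v ∈ W := by
    intro v hv
    rw [hW] at hv ⊢
    intro ν hν
    have h := internalProj_map hint (actLin M (fA P)) (σ := (· - 2)) (sub_left_injective)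
      (fun _ _ => fA_smul_mem) (ν + 2) v
    simp only [add_sub_cancel_right] at h
    refine h.trans ?_
    rw [hv, map_zero]
    rintro ⟨k, hk⟩
    refine hν ⟨k + 1, ?_⟩
    push_cast
    linear_combination hk
  have hWh : ∀ v ∈ W, hA P • v ∈ W := by
    intro v hv
    rw [hW] at hv ⊢
    intro ν hν
    refine (internalProj_map hint (actLin M (hA P)) (σ := id) Function.injective_id
      (fun _ _ => hA_smul_mem) ν v).trans ?_
    rw [hv ν hν, map_zero]
  let N : Submodule (AP P) M.V :=
    { W with smul_mem' := fun a v hv => smul_mem_of_generators_stable W hWe hWf hWh a v hv }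
  have huN : u ∈ N := (hW u).2 fun ν hν => by
    rw [internalProj_of_mem hint hu, if_neg]
    rintro rfl
    exact hν ⟨0, by simp⟩
  rcases eq_bot_or_eq_top N with hN | hN
  · rw [hN] at huN
    exact h0 huN
  · obtain ⟨x, hx, hx0⟩ := exists_ne_zero_of_mem_spec hμ
    have hxW : x ∈ W := show x ∈ N from hN ▸ Submodule.mem_top
    refine hx0 ?_
    have h := (hW x).1 hxW (μ + 2) ?_
    · rwa [internalProj_of_mem hint hx, if_pos rfl] at h
    · rintro ⟨k, hk⟩
      have h2 : ((2 * k + 2 : ℕ) : ℂ) = 0 := by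
        push_cast
        linear_combination hk
      exact absurd (Nat.cast_eq_zero.1 h2) (by omega)

lemma exists_real_of_form {B : M.V → M.V → ℂ}
    (hsmul : ∀ (c : ℂ) (u v), B (c • u) v = c * B u v)
    (hsymm : ∀ u v, B u v = starRingEnd ℂ (B v u))
    (hh : ∀ u v, B (hA P • u) v = B u (hA P • v))
    (hpos : ∀ u : M.V, u ≠ 0 → ∃ r : ℝ, 0 < r ∧ B u u = r) {μ : ℂ} (hμ : μ ∈ spec M) :
    ∃ t : ℝ, μ = (t : ℂ) := by
  obtain ⟨u, hu, h0⟩ := exists_ne_zero_of_mem_spec hμ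
  obtain ⟨r, hr, hB⟩ := hpos u h0
  have h := hh u u
  rw [mem_eigSpace.1 hu, hsmul, hsymm u (μ • u), hsmul, map_mul, hB, Complex.conj_ofReal] at h
  have hr' : (r : ℂ) ≠ 0 := by exact_mod_cast hr.ne'
  exact ⟨μ.re, (Complex.conj_eq_iff_re.1 (mul_right_cancel₀ hr' h).symm).symm⟩

lemma eval_neg_of_form (hsimple : IsSimpleModule (AP P) M.V)
    (hint : DirectSum.IsInternal (fun μ : ℂ => eigSpace M μ))
    (hone : ∀ μ ∈ spec M, Module.finrank ℂ (eigSpace M μ) = 1) {B : M.V → M.V → ℂ}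
    (hsmul : ∀ (c : ℂ) (u v), B (c • u) v = c * B u v)
    (hf : ∀ u v, B (fA P • u) v = - B u (eA P • v))
    (hpos : ∀ u : M.V, u ≠ 0 → ∃ r : ℝ, 0 < r ∧ B u u = r) {μ : ℂ} (hμ : μ ∈ spec M)
    (hμ2 : μ - 2 ∈ spec M) : ∃ r : ℝ, r < 0 ∧ P.eval (μ - 1) = (r : ℂ) := by
  obtain ⟨u, hu, h0⟩ := exists_ne_zero_of_mem_spec hμ2
  have he0 := eA_smul_ne_zero hsimple hint hone hu h0 (by rwa [sub_add_cancel])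
  obtain ⟨r, hr, hBr⟩ := hpos u h0
  obtain ⟨s, hs, hBs⟩ := hpos _ he0
  have h := hf (eA P • u) u
  rw [fA_smul_eA_smul hu, hsmul, hBr, hBs, show μ - 2 + 1 = μ - 1 by ring] at h
  have hr' : (r : ℂ) ≠ 0 := by exact_mod_cast hr.ne'
  refine ⟨-s / r, div_neg_of_neg_of_pos (neg_neg_of_pos hs) hr, ?_⟩
  push_cast
  rw [eq_div_iff hr', h]

/-- The condition `P(λ - 1) < 0` lets one rescale an invariant pairing between consecutive
weight spaces by a positive constant. -/
lemma exists_pos_ratio (hone : ∀ μ ∈ spec M, Module.finrank ℂ (eigSpace M μ) = 1)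
    (hneg : ∀ μ ∈ spec M, μ - 2 ∈ spec M → ∃ r : ℝ, r < 0 ∧ P.eval (μ - 1) = (r : ℂ))
    (φ : ℂ → M.V →ₗ[ℂ] ℂ) (hφ : ∀ μ, ∀ u ∈ eigSpace M μ, φ μ u = 0 → u = 0) (μ : ℂ) :
    ∃ g : ℝ, 0 < g ∧ ∀ x ∈ eigSpace M μ, ∀ y ∈ eigSpace M (μ + 2),
      g * (φ (μ + 2) (eA P • x) * starRingEnd ℂ (φ (μ + 2) y)) =
        -(φ μ x * starRingEnd ℂ (φ μ (fA P • y))) := by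
  by_cases h1 : μ ∈ spec M
  swap
  · refine ⟨1, one_pos, fun x hx y _ => ?_⟩
    have : x = 0 := by_contra fun h => h1 (mem_spec_of_ne_zero hx h)
    simp [this]
  by_cases h2 : μ + 2 ∈ spec M
  swap
  · refine ⟨1, one_pos, fun x _ y hy => ?_⟩
    have : y = 0 := by_contra fun h => h2 (mem_spec_of_ne_zero hy h)
    simp [this]
  obtain ⟨r, hr, hP⟩ := hneg _ h2 (by rwa [add_sub_cancel_right])
  rw [show μ + 2 - 1 = μ + 1 by ring] at hP
  have hr' : (r : ℂ) ≠ 0 := by exact_mod_cast hr.ne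
  obtain ⟨z, hz, hz0⟩ := exists_ne_zero_of_mem_spec h1
  have hfe := fA_smul_eA_smul hz
  rw [hP] at hfe
  have hez : eA P • z ≠ 0 := fun h => by
    rw [h, smul_zero] at hfe
    exact (smul_ne_zero hr' hz0) hfe.symm
  have ha : φ μ z ≠ 0 := fun h => hz0 (hφ _ _ hz h)
  have hb : φ (μ + 2) (eA P • z) ≠ 0 := fun h => hez (hφ _ _ (eA_smul_mem hz) h)
  set a := φ μ z with ha_def
  set b := φ (μ + 2) (eA P • z) with hb_def
  have hb' : starRingEnd ℂ b ≠ 0 := (_root_.map_ne_zero _).2 hb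
  refine ⟨-r * Complex.normSq a / Complex.normSq b,
    div_pos (mul_pos (neg_pos.2 hr) (Complex.normSq_pos.2 ha)) (Complex.normSq_pos.2 hb),
    fun x hx y hy => ?_⟩
  obtain ⟨s, rfl⟩ := exists_smul_eq hone hz hz0 hx
  obtain ⟨t, rfl⟩ := exists_smul_eq hone (eA_smul_mem hz) hez hy
  rw [← smul_comm s (eA P) z, ← smul_comm t (fA P), hfe]
  simp only [map_smul, smul_eq_mul, map_mul, Complex.conj_ofReal, ← ha_def, ← hb_def]
  push_cast
  rw [Complex.normSq_eq_conj_mul_self, Complex.normSq_eq_conj_mul_self]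
  field_simp

/-- The diagonal Hermitian form attached to weights `w` and coordinates `ψ`. -/
def diagForm {ι V : Type*} [AddCommGroup V] [Module ℂ V] (w : ι → ℝ) (ψ : ι → V →ₗ[ℂ] ℂ)
    (u v : V) : ℂ :=
  ∑ᶠ i, (w i : ℂ) * (ψ i u * starRingEnd ℂ (ψ i v))

section DiagForm

variable {ι V : Type*} [AddCommGroup V] [Module ℂ V] {w : ι → ℝ} {ψ : ι → V →ₗ[ℂ] ℂ}

lemma finite_support_diagForm (hψ : ∀ u, {i | ψ i u ≠ 0}.Finite) (u v : V) :
    (Function.support fun i => (w i : ℂ) * (ψ i u * starRingEnd ℂ (ψ i v))).Finite :=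
  (hψ u).subset fun i hi h => hi (by simp [h])

lemma diagForm_add_left (hψ : ∀ u, {i | ψ i u ≠ 0}.Finite) (u v x : V) :
    diagForm w ψ (u + v) x = diagForm w ψ u x + diagForm w ψ v x := by
  rw [diagForm, diagForm, diagForm, ← finsum_add_distrib (finite_support_diagForm hψ u x)
    (finite_support_diagForm hψ v x)]
  exact finsum_congr fun i => by rw [map_add]; ring

lemma diagForm_smul_left (c : ℂ) (u v : V) :
    diagForm w ψ (c • u) v = c * diagForm w ψ u v := by
  rw [diagForm, diagForm, ← smul_eq_mul c, smul_finsum]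
  exact finsum_congr fun i => by rw [map_smul, smul_eq_mul, smul_eq_mul]; ring

lemma diagForm_conj_symm (hψ : ∀ u, {i | ψ i u ≠ 0}.Finite) (u v : V) :
    diagForm w ψ u v = starRingEnd ℂ (diagForm w ψ v u) := by
  refine Eq.trans (finsum_congr fun i => ?_) (AddMonoidHom.map_finsum
    (starRingEnd ℂ).toAddMonoidHom (finite_support_diagForm hψ v u)).symm
  simp [mul_comm]

lemma diagForm_self_pos (hψ : ∀ u, {i | ψ i u ≠ 0}.Finite) (hw : ∀ i, 0 < w i)
    (hsep : ∀ u, (∀ i, ψ i u = 0) → u = 0) {u : V} (hu : u ≠ 0) :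
    ∃ r : ℝ, 0 < r ∧ diagForm w ψ u u = r := by
  have hterm : ∀ i, (w i : ℂ) * (ψ i u * starRingEnd ℂ (ψ i u)) =
      ((w i * Complex.normSq (ψ i u) : ℝ) : ℂ) := fun i => by
    rw [Complex.mul_conj]; push_cast; rfl
  have hfin : (Function.support fun i => w i * Complex.normSq (ψ i u)).Finite :=
    (hψ u).subset fun i hi h => hi (by simp [h])
  refine ⟨∑ᶠ i, w i * Complex.normSq (ψ i u), ?_, ?_⟩
  · obtain ⟨i, hi⟩ : ∃ i, ψ i u ≠ 0 := by
      by_contra! h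
      exact hu (hsep u h)
    exact finsum_pos (fun i => mul_nonneg (hw i).le (Complex.normSq_nonneg _))
      ⟨i, mul_pos (hw i) (Complex.normSq_pos.2 hi)⟩ hfin
  · rw [diagForm, finsum_congr hterm]
    exact (AddMonoidHom.map_finsum Complex.ofRealHom.toAddMonoidHom hfin).symm

end DiagForm

lemma exists_form (hint : DirectSum.IsInternal (fun μ : ℂ => eigSpace M μ))
    (hone : ∀ μ ∈ spec M, Module.finrank ℂ (eigSpace M μ) = 1)
    (hreal : ∀ μ ∈ spec M, ∃ t : ℝ, μ = (t : ℂ))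
    (hneg : ∀ μ ∈ spec M, μ - 2 ∈ spec M → ∃ r : ℝ, r < 0 ∧ P.eval (μ - 1) = (r : ℂ)) :
    ∃ B : M.V → M.V → ℂ,
      (∀ u v w, B (u + v) w = B u w + B v w) ∧
      (∀ (c : ℂ) (u v), B (c • u) v = c * B u v) ∧
      (∀ u v, B u v = starRingEnd ℂ (B v u)) ∧
      (∀ u v, B (hA P • u) v = B u (hA P • v)) ∧
      (∀ u v, B (eA P • u) v = - B u (fA P • v)) ∧
      (∀ u v, B (fA P • u) v = - B u (eA P • v)) ∧
      (∀ u : M.V, u ≠ 0 → ∃ r : ℝ, 0 < r ∧ B u u = r) := by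
  have hφ : ∀ μ, ∃ φ : M.V →ₗ[ℂ] ℂ, ∀ u ∈ eigSpace M μ, φ u = 0 → u = 0 := by
    intro μ
    by_cases hμ : μ ∈ spec M
    · obtain ⟨z, hz, hz0⟩ := exists_ne_zero_of_mem_spec hμ
      obtain ⟨φ, hφ⟩ := Module.Projective.exists_dual_eq_one ℂ hz0
      refine ⟨φ, fun u hu h => ?_⟩
      obtain ⟨c, rfl⟩ := exists_smul_eq hone hz hz0 hu
      rw [map_smul, hφ, smul_eq_mul, mul_one] at h
      rw [h, zero_smul]
    · exact ⟨0, fun u hu _ => by_contra fun h => hμ (mem_spec_of_ne_zero hu h)⟩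
  choose φ hφ using hφ
  choose g hg hg' using exists_pos_ratio hone hneg φ hφ
  obtain ⟨w, hw, hw'⟩ := exists_pos_weight g hg
  let ψ : ℂ → M.V →ₗ[ℂ] ℂ := fun μ => φ μ ∘ₗ internalProj hint μ
  have hfin : ∀ u, {μ | ψ μ u ≠ 0}.Finite := fun u =>
    (finite_support_internalProj hint u).subset fun μ hμ h => hμ (by simp [ψ, h])
  have hsep : ∀ u, (∀ μ, ψ μ u = 0) → u = 0 := fun u h =>
    eq_zero_of_internalProj_eq_zero hint fun μ => hφ μ _ (internalProj_mem hint μ u) (h μ)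
  have hψh : ∀ μ u, ψ μ (hA P • u) = μ * ψ μ u := by
    intro μ u
    have h := internalProj_map hint (actLin M (hA P)) (σ := id) Function.injective_id
      (fun _ _ => hA_smul_mem) μ u
    have h' : internalProj hint μ (hA P • u) = μ • internalProj hint μ u :=
      h.trans (mem_eigSpace.1 (internalProj_mem hint μ u))
    simp [ψ, h']
  have hψe : ∀ μ u, ψ (μ + 2) (eA P • u) = φ (μ + 2) (eA P • internalProj hint μ u) :=
    fun μ u => congrArg (φ (μ + 2)) (internalProj_map hint (actLin M (eA P)) (σ := (· + 2))
      (add_left_injective 2) (fun _ _ => eA_smul_mem) μ u)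
  have hψf : ∀ μ u, ψ μ (fA P • u) = φ μ (fA P • internalProj hint (μ + 2) u) := by
    intro μ u
    have h := internalProj_map hint (actLin M (fA P)) (σ := (· - 2)) sub_left_injective
      (fun _ _ => fA_smul_mem) (μ + 2) u
    simp only [add_sub_cancel_right] at h
    exact congrArg (φ μ) h
  have hzero : ∀ μ ∉ spec M, ∀ u, ψ μ u = 0 := fun μ hμ u => by
    have : internalProj hint μ u = 0 :=
      by_contra fun h => hμ (mem_spec_of_ne_zero (internalProj_mem hint μ u) h)
    simp [ψ, this]
  have hef : ∀ u v, diagForm w ψ (eA P • u) v = - diagForm w ψ u (fA P • v) := by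
    intro u v
    rw [diagForm, diagForm, ← finsum_neg_distrib, ← finsum_comp_equiv (Equiv.addRight (2 : ℂ))]
    refine finsum_congr fun μ => ?_
    have h := hg' μ _ (internalProj_mem hint μ u) _ (internalProj_mem hint (μ + 2) v)
    rw [Equiv.coe_addRight, hw', hψe, hψf]
    push_cast
    simp only [ψ, LinearMap.comp_apply]
    linear_combination (w μ : ℂ) * h
  refine ⟨diagForm w ψ, diagForm_add_left hfin, diagForm_smul_left, diagForm_conj_symm hfin,
    fun u v => finsum_congr fun μ => ?_, hef, fun u v => ?_,
    fun u hu => diagForm_self_pos hfin hw hsep hu⟩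
  · by_cases hμ : μ ∈ spec M
    · obtain ⟨t, ht⟩ := hreal μ hμ
      rw [hψh, hψh, map_mul, ht, Complex.conj_ofReal]
      ring
    · simp [hzero μ hμ]
  · rw [diagForm_conj_symm hfin, diagForm_conj_symm hfin u, hef, map_neg, neg_neg]

end Module

/-- for `n` even and `P ∈ ℝ[x]` even of degree `n`, a simple `𝒜(P)`-module `V`
which is the direct sum of its one-dimensional `h`-eigenspaces, with eigenvalue set `Λ`,
carries a positive definite Hermitian form with `(hu,v) = (u,hv)`, `(eu,v) = −(u,fv)`,
`(fu,v) = −(u,ev)` if and only if `Λ ⊆ ℝ` and `P(λ−1) < 0` for all `λ ∈ Λ'`, where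
`Λ' = {λ ∈ Λ | λ − 2 ∈ Λ}` is `Λ` with its smallest element (if any) removed. -/
theorem stmt4 (n m : ℕ) (hn : n = 2 * m) (hn1 : 1 ≤ n) (P : ℂ[X])
    (hdeg : P.natDegree = n)
    (hrealcoeff : ∀ k : ℕ, ∃ r : ℝ, P.coeff k = r)
    (heven : P.comp (-X) = P)
    (M : APMod P) (hsimple : IsSimpleModule (AP P) M.V)
    (hint : DirectSum.IsInternal (fun μ : ℂ => eigSpace M μ))
    (hone : ∀ μ ∈ spec M, Module.finrank ℂ (eigSpace M μ) = 1) :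
    (∃ B : M.V → M.V → ℂ,
      (∀ u v w, B (u + v) w = B u w + B v w) ∧
      (∀ (c : ℂ) (u v), B (c • u) v = c * B u v) ∧
      (∀ u v, B u v = starRingEnd ℂ (B v u)) ∧
      (∀ u v, B (hA P • u) v = B u (hA P • v)) ∧
      (∀ u v, B (eA P • u) v = - B u (fA P • v)) ∧
      (∀ u v, B (fA P • u) v = - B u (eA P • v)) ∧
      (∀ u : M.V, u ≠ 0 → ∃ r : ℝ, 0 < r ∧ B u u = r)) ↔
    ((∀ μ ∈ spec M, ∃ t : ℝ, μ = (t : ℂ)) ∧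
      ∀ μ ∈ spec M, μ - 2 ∈ spec M → ∃ r : ℝ, r < 0 ∧ P.eval (μ - 1) = (r : ℂ)) := by
  constructor
  · rintro ⟨B, -, hsmul, hsymm, hh, -, hf, hpos⟩
    exact ⟨fun μ hμ => exists_real_of_form hsmul hsymm hh hpos hμ,
      fun μ hμ hμ2 => eval_neg_of_form hsimple hint hone hsmul hf hpos hμ hμ2⟩
  · rintro ⟨hreal, hneg⟩
    exact exists_form hint hone hreal hneg

end
end

section
/- Let P ∈ ℂ[x] satisfy P(x) = P̄(−x). Suppose that either (1) P has at least three roots α, counted with multiplicity, with |Re α| < 1, or (2) P has at least two roots α, counted with multiplicity, with |Re α| < 1, P has degree 2m, and the leading coefficient of P is a real number of sign (−1)^m. Then there is no nonzero F ∈ ℂ[x] such that Re F(x) ≥ 0 for every x ∈ ℂ with Re x = 0 and Re(F(x−1)·P(x−1)) ≥ 0 for every x ∈ ℂ with Re x = 0. -/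
open Polynomial
open scoped Classical

noncomputable section

/-- `pconj F` is the polynomial `F̄(−x)`, where `F̄` has the conjugate coefficients. -/
def pconj (F : ℂ[X]) : ℂ[X] := (F.map (starRingEnd ℂ)).comp (-X)

/-- `re0 F` is the polynomial `(F(x) + F̄(−x))/2`; it is the unique polynomial agreeing with
`Re (F(x))` on the imaginary axis. -/
def re0 (F : ℂ[X]) : ℂ[X] := (2⁻¹ : ℂ) • (F + pconj F)

open Complex ComplexConjugate Filter Topology

/-- A function on `ℂ` with values in the slit plane that intertwines the reflection `α ↦ -ᾱ` with
conjugation has positive product over every multiset invariant under that reflection. -/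
lemma exists_pos_multiset_prod_map {M : Multiset ℂ} (hM : M.map (fun α => -conj α) = M)
    {f : ℂ → ℂ} (hf : ∀ α, f (-conj α) = conj (f α)) (hs : ∀ α ∈ M, f α ∈ slitPlane) :
    ∃ r : ℝ, 0 < r ∧ (M.map f).prod = r := by
  have hexp : (M.map f).prod = exp (M.map fun α => log (f α)).sum := by
    rw [Complex.exp_multiset_sum, Multiset.map_map]
    congr 1
    exact Multiset.map_congr rfl fun α hα => (exp_log (slitPlane_ne_zero (hs α hα))).symm
  have hconj : conj (M.map fun α => log (f α)).sum = (M.map fun α => log (f α)).sum := by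
    rw [map_multiset_sum, Multiset.map_map]
    conv_rhs => rw [← hM, Multiset.map_map]
    congr 1
    refine Multiset.map_congr rfl fun α hα => ?_
    simp only [Function.comp_apply, hf]
    exact (log_conj _ (mem_slitPlane_iff_arg.1 (hs α hα)).1).symm
  obtain ⟨s, hs⟩ := conj_eq_iff_real.1 hconj
  exact ⟨Real.exp s, Real.exp_pos s, by rw [hexp, hs, ofReal_exp]⟩

lemma conj_multiset_prod_map {M : Multiset ℂ} (hM : M.map (fun α => -conj α) = M)
    {f : ℂ → ℂ} (hf : ∀ α, f (-conj α) = conj (f α)) :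
    conj (M.map f).prod = (M.map f).prod := by
  rw [map_multiset_prod, Multiset.map_map]
  conv_rhs => rw [← hM, Multiset.map_map]
  congr 1
  exact Multiset.map_congr rfl fun α _ => (hf α).symm

lemma eval_pconj (F : ℂ[X]) (x : ℂ) : (pconj F).eval x = conj (F.eval (-conj x)) := by
  rw [pconj, eval_comp, eval_map, ← eval₂_at_apply]
  simp

lemma roots_pconj (F : ℂ[X]) : (pconj F).roots = F.roots.map fun α => -conj α := by
  rw [pconj, roots_comp_neg_X, (IsAlgClosed.splits F).roots_map, Multiset.map_map]
  rfl

lemma map_filter_roots_of_pconj_eq {P : ℂ[X]} (hP : pconj P = P) :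
    (P.roots.filter fun z => |z.re| < 1).map (fun α => -conj α) =
      P.roots.filter fun z => |z.re| < 1 := by
  conv_rhs => rw [← hP, roots_pconj, Multiset.filter_map]
  congr 1
  refine Multiset.filter_congr fun α _ => ?_
  simp

/-- If `f` is holomorphic on the strip `-1 ≤ Re z ≤ 0`, tends to zero at its ends, and has
nonnegative real part on the right edge and nonpositive real part on the left edge, then both these
real parts vanish. -/
lemma re_eq_zero_of_strip {f : ℂ → ℂ} (hd : ∀ z : ℂ, -1 ≤ z.re → z.re ≤ 0 → DifferentiableAt ℂ f z)
    (hright : ∀ t : ℝ, 0 ≤ (f (t * I)).re) (hleft : ∀ t : ℝ, (f (-1 + t * I)).re ≤ 0)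
    (hlim : Tendsto f (comap (fun z => |z.im|) atTop ⊓ 𝓟 {z | |z.re| ≤ 1}) (𝓝 0)) (t : ℝ) :
    (f (t * I)).re = 0 ∧ (f (-1 + t * I)).re = 0 := by
  have hcr : Continuous fun y : ℝ => f (y * I) := by
    refine continuous_iff_continuousAt.2 fun y => ?_
    exact ContinuousAt.comp (f := fun y : ℝ => (y * I : ℂ)) (hd _ (by simp) (by simp)).continuousAt
      (by fun_prop)
  have hcl : Continuous fun y : ℝ => f (-1 + y * I) := by
    refine continuous_iff_continuousAt.2 fun y => ?_
    exact ContinuousAt.comp (f := fun y : ℝ => (-1 + y * I : ℂ))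
      (hd _ (by simp) (by simp)).continuousAt (by fun_prop)
  set g : ℝ → ℝ := fun y => (f (y * I)).re - (f (-1 + y * I)).re with hg
  have hgc : Continuous g := (continuous_re.comp hcr).sub (continuous_re.comp hcl)
  have hg0 : ∀ y, 0 ≤ g y := fun y => by have := hright y; have := hleft y; simp only [hg]; linarith
  have hint : ∀ ε : ℝ, 0 < ε → ∀ T₁ : ℝ, 0 ≤ T₁ → ∫ y in (-T₁)..T₁, g y ≤ 2 * ε := by
    intro ε hε T₁ hT₁
    have h1 := hlim (Metric.closedBall_mem_nhds 0 hε)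
    rw [mem_map, mem_inf_principal, mem_comap] at h1
    obtain ⟨s, hs, hsub⟩ := h1
    obtain ⟨T₀, hT₀⟩ := mem_atTop_sets.1 hs
    obtain ⟨T, hT1, hT0⟩ : ∃ T, T₁ ≤ T ∧ T₀ ≤ T := ⟨max T₁ T₀, le_max_left _ _, le_max_right _ _⟩
    have hb : ∀ z : ℂ, |z.re| ≤ 1 → |z.im| = T → ‖f z‖ ≤ ε := fun z hz hzT => by
      have := hsub (show z ∈ (fun z : ℂ => |z.im|) ⁻¹' s from hT₀ _ (hT0.trans_eq hzT.symm)) hz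
      simpa using this
    have hTn : 0 ≤ T := hT₁.trans hT1
    have hrect := Complex.integral_boundary_rect_eq_zero_of_differentiableOn f (-1 + (-T : ℝ) * I)
      ((T : ℝ) * I) (fun z hz => by
        have hz := hz.1
        simp [Set.uIcc_of_le] at hz
        exact (hd z hz.1 hz.2).differentiableWithinAt)
    simp only [add_re, neg_re, one_re, mul_re, ofReal_re, I_re, mul_zero, ofReal_im, I_im, mul_one,
      sub_self, add_zero, add_im, neg_im, one_im, mul_im, zero_add, neg_zero, ofReal_zero,
      ofReal_neg, ofReal_one] at hrect
    have hedge : ∀ c : ℝ, |c| = T → ‖∫ x : ℝ in (-1 : ℝ)..0, f (x + c * I)‖ ≤ ε := by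
      intro c hc
      have := intervalIntegral.norm_integral_le_of_norm_le_const (a := (-1 : ℝ)) (b := 0) (C := ε)
        (f := fun x : ℝ => f (x + c * I)) (fun x hx => by
          rw [Set.uIoc_of_le (by norm_num)] at hx
          refine hb _ ?_ (by simpa using hc)
          simp only [add_re, ofReal_re, mul_re, I_re, mul_zero, ofReal_im, I_im, mul_one, sub_self,
            add_zero]
          exact abs_le.2 ⟨hx.1.le, hx.2.trans zero_le_one⟩)
      simpa using this
    have hlow := hedge (-T) (by rw [abs_neg, abs_of_nonneg hTn])
    have hupp := hedge T (abs_of_nonneg hTn)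
    have hre : (∫ y in (-T)..T, g y) =
        ((∫ y : ℝ in (-T)..T, f (y * I)) - ∫ y : ℝ in (-T)..T, f (-1 + y * I)).re := by
      rw [← intervalIntegral.integral_sub (hcr.intervalIntegrable _ _)
        (hcl.intervalIntegrable _ _)]
      exact (reCLM.intervalIntegral_comp_comm ((hcr.sub hcl).intervalIntegrable (-T) T))
    have hle : ∫ y in (-T₁)..T₁, g y ≤ ∫ y in (-T)..T, g y :=
      intervalIntegral.integral_mono_interval (by linarith) (by linarith) hT1
        (Eventually.of_forall hg0) (hgc.intervalIntegrable _ _)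
    refine hle.trans (hre.trans_le ((re_le_norm _).trans ?_))
    rw [ofReal_neg] at hlow
    have hI : I * ((∫ y : ℝ in (-T)..T, f (y * I)) - ∫ y : ℝ in (-T)..T, f (-1 + y * I)) =
        (∫ x : ℝ in (-1 : ℝ)..0, f (x + T * I)) - ∫ x : ℝ in (-1 : ℝ)..0, f (x + -T * I) := by
      simp only [smul_eq_mul] at hrect
      linear_combination hrect
    calc _ = ‖I * ((∫ y : ℝ in (-T)..T, f (y * I)) - ∫ y : ℝ in (-T)..T, f (-1 + y * I))‖ := by
            rw [norm_mul, norm_I, one_mul]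
      _ ≤ ε + ε := by
            rw [hI]
            exact (norm_sub_le _ _).trans (add_le_add hupp hlow)
      _ = 2 * ε := by ring
  have hgt : g t = 0 := by
    by_contra hne
    have hpos : 0 < g t := lt_of_le_of_ne (hg0 t) (Ne.symm hne)
    have hT : 0 < |t| + 1 := by positivity
    have h1 : 0 < ∫ y in (-(|t| + 1))..(|t| + 1), g y :=
      intervalIntegral.integral_pos (by linarith) hgc.continuousOn (fun y _ => hg0 y)
        ⟨t, ⟨by linarith [neg_abs_le t], by linarith [le_abs_self t]⟩, hpos⟩
    have h2 := hint ((∫ y in (-(|t| + 1))..(|t| + 1), g y) / 4) (by linarith) _ hT.le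
    linarith
  have h1 := hright t
  have h2 := hleft t
  simp only [hg] at hgt
  constructor <;> linarith

/-- Polynomials grow slower than `exp (π |Im z|)` at the ends of the strip `|Re z| ≤ 1`. -/
lemma tendsto_norm_eval_mul_exp_strip (G : ℂ[X]) :
    Tendsto (fun z : ℂ => ‖G.eval z‖ * Real.exp (-(Real.pi * |z.im|)))
      (comap (fun z => |z.im|) atTop ⊓ 𝓟 {z | |z.re| ≤ 1}) (𝓝 0) := by
  induction G using Polynomial.induction_on' with
  | add p q hp hq =>
    refine squeeze_zero (fun z => by positivity) (fun z => ?_) (by simpa using hp.add hq)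
    rw [eval_add, ← add_mul]
    gcongr
    exact norm_add_le _ _
  | monomial n a =>
    have h0 : Tendsto (fun u : ℝ => ‖a‖ * Real.exp 1 * ((1 + u) ^ n * Real.exp (-(1 + u)))) atTop
        (𝓝 0) := by
      simpa using ((Real.tendsto_pow_mul_exp_neg_atTop_nhds_zero n).comp
        (tendsto_atTop_add_const_left atTop (1 : ℝ) tendsto_id)).const_mul (‖a‖ * Real.exp 1)
    have h1 : Tendsto (fun z : ℂ => |z.im|) (comap (fun z => |z.im|) atTop ⊓ 𝓟 {z | |z.re| ≤ 1})
        atTop := tendsto_comap.mono_left inf_le_left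
    refine squeeze_zero' (Eventually.of_forall fun z => by positivity) ?_ (h0.comp h1)
    filter_upwards [mem_inf_of_right (mem_principal_self _)] with z hz
    have hz' : ‖z‖ ≤ 1 + |z.im| := (norm_le_abs_re_add_abs_im z).trans (by gcongr)
    rw [eval_monomial, norm_mul, norm_pow, Function.comp_apply]
    have he : Real.exp 1 * Real.exp (-(1 + |z.im|)) = Real.exp (-|z.im|) := by
      rw [← Real.exp_add, add_comm, neg_add_rev, neg_add_cancel_right]
    calc ‖a‖ * ‖z‖ ^ n * Real.exp (-(Real.pi * |z.im|))
        ≤ ‖a‖ * (1 + |z.im|) ^ n * Real.exp (-|z.im|) := by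
          gcongr
          nlinarith [Real.pi_gt_three, abs_nonneg z.im]
      _ = _ := by rw [← he]; ring

lemma exists_norm_pow_div_prod_le {M : Multiset ℂ} (hM : (0 : ℂ) ∉ M) {j : ℕ} (hj : 1 ≤ j)
    (hjM : j < M.card) :
    ∃ C δ : ℝ, 0 < δ ∧ ∀ z : ℂ, z ≠ 0 →
      (‖z‖ < δ → ‖z ^ j / (M.map fun a => z - a).prod‖ ≤ C * ‖z‖) ∧
      (‖z⁻¹‖ < δ → ‖z ^ j / (M.map fun a => z - a).prod‖ ≤ C * ‖z⁻¹‖) := by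
  have hbdd : ∀ (f : ℂ → ℂ) (n : ℕ), Continuous f → f 0 ≠ 0 →
      ∃ C, ∀ᶠ z in 𝓝 (0 : ℂ), ‖z ^ n / f z‖ < C := fun f n hf h0 =>
    ⟨_, (((continuousAt_id.pow n).div hf.continuousAt h0).norm.eventually
      (gt_mem_nhds (lt_add_one _)))⟩
  obtain ⟨C₁, h₁⟩ := hbdd (fun z => (M.map fun a => z - a).prod) (j - 1)
    (continuous_multiset_prod _ fun a _ => by fun_prop) (by
      rw [ne_eq, Multiset.prod_eq_zero_iff]
      simpa using hM)
  obtain ⟨C₂, h₂⟩ := hbdd (fun z => (M.map fun a => 1 - a * z).prod) (M.card - j - 1)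
    (continuous_multiset_prod _ fun a _ => by fun_prop) (by simp)
  obtain ⟨δ, hδ, h⟩ := Metric.eventually_nhds_iff.1 (h₁.and h₂)
  simp only [dist_zero_right] at h
  refine ⟨max C₁ C₂, δ, hδ, fun z hz => ⟨fun hzδ => ?_, fun hzδ => ?_⟩⟩
  · have hpow : z ^ j = z ^ (j - 1) * z := by rw [← pow_succ, Nat.sub_add_cancel hj]
    rw [hpow, mul_div_right_comm, norm_mul]
    gcongr
    exact (h hzδ).1.le.trans (le_max_left _ _)
  · have hprod : (M.map fun a => z - a).prod =
        z ^ M.card * (M.map fun a => 1 - a * z⁻¹).prod := by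
      rw [← Multiset.prod_replicate, ← Multiset.map_const', ← Multiset.prod_map_mul]
      congr 1
      refine Multiset.map_congr rfl fun a _ => ?_
      field_simp
    have hpow : z ^ j * (z ^ (M.card - j - 1) * z) = z ^ M.card := by
      rw [← pow_succ, ← pow_add]
      congr 1
      omega
    have heq : z ^ j / (M.map fun a => z - a).prod =
        z⁻¹ ^ (M.card - j - 1) / (M.map fun a => 1 - a * z⁻¹).prod * z⁻¹ := by
      have hw : z⁻¹ ^ (M.card - j - 1) * z⁻¹ * (z ^ (M.card - j - 1) * z) = 1 := by
        rw [mul_mul_mul_comm, ← mul_pow, inv_mul_cancel₀ hz, one_pow, one_mul]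
      have hw' : z ^ (M.card - j - 1) * z ≠ 0 := mul_ne_zero (pow_ne_zero _ hz) hz
      rw [hprod, ← hpow, div_mul_eq_mul_div, mul_assoc, div_mul_cancel_left₀ (pow_ne_zero _ hz),
        eq_one_div_of_mul_eq_one_left hw, div_div, one_div]
    rw [heq, norm_mul]
    gcongr
    exact (h hzδ).2.le.trans (le_max_right _ _)

/-- The exponential with period `2` that is real on the lines `Re z ∈ ℤ`. -/
def expPi (z : ℂ) : ℂ := exp (Real.pi * I * z)

lemma expPi_ne_zero (z : ℂ) : expPi z ≠ 0 := exp_ne_zero _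

lemma differentiable_expPi : Differentiable ℂ expPi := by
  unfold expPi
  fun_prop

lemma norm_expPi (z : ℂ) : ‖expPi z‖ = Real.exp (-(Real.pi * z.im)) := by
  simp [expPi, norm_exp]

lemma expPi_neg_conj (z : ℂ) : expPi (-conj z) = conj (expPi z) := by
  simp [expPi, ← exp_conj]

lemma expPi_mul_I (t : ℝ) : expPi (t * I) = (Real.exp (-(Real.pi * t)) : ℝ) := by
  rw [expPi, ofReal_exp]
  congr 1
  push_cast
  linear_combination (Real.pi * t : ℂ) * I_mul_I

lemma expPi_neg_one_add_mul_I (t : ℝ) :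
    expPi (-1 + t * I) = -(Real.exp (-(Real.pi * t)) : ℝ) := by
  rw [← expPi_mul_I, expPi, expPi, mul_add, exp_add, mul_neg_one, exp_neg, exp_pi_mul_I]
  norm_num

lemma eq_of_expPi_eq {z α : ℂ} (hz : |z.re| ≤ 1) (hα : |α.re| < 1) (h : expPi z = expPi α) :
    z = α := by
  obtain ⟨n, hn⟩ := exp_eq_exp_iff_exists_int.1 h
  have hz' : z = α + 2 * n := by
    have hpi : (Real.pi * I : ℂ) ≠ 0 := by simp [Real.pi_ne_zero]
    refine mul_left_cancel₀ hpi ?_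
    rw [hn]
    ring
  have hre : z.re = α.re + 2 * n := by rw [hz']; simp
  rw [hre] at hz
  have h1 := abs_le.1 hz
  have h2 := abs_lt.1 hα
  have hn1 : (n : ℝ) < 1 := by linarith
  have hn2 : (-1 : ℝ) < n := by linarith
  have hn0 : n = 0 := by
    have h3 : n < 1 := by exact_mod_cast hn1
    have h4 : -1 < n := by exact_mod_cast hn2
    omega
  simpa [hn0] using hz'

lemma add_expPi_mem_slitPlane {y : ℝ} (hy : 0 < y) {α : ℂ} (hα : |α.re| < 1) :
    y + expPi α ∈ slitPlane := by
  by_contra h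
  rw [mem_slitPlane_iff, not_or, not_lt, not_not] at h
  have harg : (Real.pi * I * α).im = Real.pi * α.re := by simp
  have hre : (expPi α).re = Real.exp (-(Real.pi * α.im)) * Real.cos (Real.pi * α.re) := by
    rw [expPi, exp_re, harg]; simp
  have him : (expPi α).im = Real.exp (-(Real.pi * α.im)) * Real.sin (Real.pi * α.re) := by
    rw [expPi, exp_im, harg]; simp
  have hsin : Real.sin (Real.pi * α.re) = 0 := by
    have := h.2
    rw [add_im, ofReal_im, zero_add, him] at this
    exact (mul_eq_zero.1 this).resolve_left (Real.exp_ne_zero _)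
  have h1 := abs_lt.1 hα
  have h0 := (Real.sin_eq_zero_iff_of_lt_of_lt (by nlinarith [Real.pi_pos])
    (by nlinarith [Real.pi_pos])).1 hsin
  have := h.1
  rw [add_re, ofReal_re, hre, h0, Real.cos_zero, mul_one] at this
  linarith [Real.exp_pos (-(Real.pi * α.im))]

lemma tendsto_eval_mul_expPi_pow_div {S : Multiset ℂ} (G : ℂ[X]) {j : ℕ} (hj : 1 ≤ j)
    (hjS : j < S.card) :
    Tendsto (fun z => G.eval z * (expPi z ^ j / (S.map fun α => expPi z - expPi α).prod))
      (comap (fun z => |z.im|) atTop ⊓ 𝓟 {z | |z.re| ≤ 1}) (𝓝 0) := by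
  obtain ⟨C, δ, hδ, h⟩ := exists_norm_pow_div_prod_le (M := S.map expPi) (j := j)
    (by simp [expPi_ne_zero]) hj (by simpa using hjS)
  have hexp : Tendsto (fun z : ℂ => Real.exp (-(Real.pi * |z.im|)))
      (comap (fun z => |z.im|) atTop ⊓ 𝓟 {z | |z.re| ≤ 1}) (𝓝 0) :=
    Real.tendsto_exp_neg_atTop_nhds_zero.comp ((tendsto_comap.mono_left inf_le_left).const_mul_atTop
      Real.pi_pos)
  refine squeeze_zero_norm' ?_ (by simpa using (tendsto_norm_eval_mul_exp_strip G).const_mul C)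
  filter_upwards [hexp.eventually (gt_mem_nhds hδ)] with z hz
  have hb : ‖expPi z ^ j / (S.map fun α => expPi z - expPi α).prod‖ ≤
      C * Real.exp (-(Real.pi * |z.im|)) := by
    have h' := h (expPi z) (expPi_ne_zero z)
    rw [Multiset.map_map] at h'
    rcases le_total 0 z.im with h0 | h0
    · rw [abs_of_nonneg h0, ← norm_expPi] at hz ⊢
      exact h'.1 hz
    · have hinv : Real.exp (-(Real.pi * |z.im|)) = ‖(expPi z)⁻¹‖ := by
        rw [norm_inv, norm_expPi, ← Real.exp_neg, abs_of_nonpos h0]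
        ring_nf
      rw [hinv] at hz ⊢
      exact h'.2 hz
  rw [norm_mul]
  calc _ ≤ ‖G.eval z‖ * (C * Real.exp (-(Real.pi * |z.im|))) := by gcongr
    _ = _ := by ring

lemma exists_differentiable_mul_prod_sub (S : Multiset ℂ) (hS : ∀ α ∈ S, |α.re| < 1) :
    ∃ V : ℂ → ℂ, Differentiable ℂ V ∧ (∀ z : ℂ, |z.re| ≤ 1 → V z ≠ 0) ∧
      ∀ z, V z * (S.map fun α => z - α).prod = (S.map fun α => expPi z - expPi α).prod := by
  induction S using Multiset.induction with
  | empty => exact ⟨fun _ => 1, by fun_prop, by simp, by simp⟩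
  | cons α S ih =>
    obtain ⟨V, hV, hV0, hVS⟩ := ih fun β hβ => hS β (Multiset.mem_cons_of_mem hβ)
    have hα := hS α (Multiset.mem_cons_self α S)
    have hd : Differentiable ℂ (dslope expPi α) := by
      rw [← differentiableOn_univ, differentiableOn_dslope univ_mem, differentiableOn_univ]
      exact differentiable_expPi
    refine ⟨fun z => dslope expPi α z * V z, hd.mul hV, fun z hz => mul_ne_zero ?_ (hV0 z hz),
      fun z => ?_⟩
    · rcases eq_or_ne z α with rfl | hne
      · have hderiv : HasDerivAt expPi (expPi z * (Real.pi * I)) z := by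
          have := ((hasDerivAt_id z).const_mul (Real.pi * I : ℂ)).cexp
          rwa [mul_one] at this
        rw [dslope_same, hderiv.deriv]
        simp [expPi_ne_zero, Real.pi_ne_zero]
      · intro h0
        have := sub_smul_dslope expPi α z
        rw [h0, smul_zero] at this
        exact hne (eq_of_expPi_eq hz hα (sub_eq_zero.1 this.symm))
    · have := sub_smul_dslope expPi α z
      rw [smul_eq_mul] at this
      rw [Multiset.map_cons, Multiset.prod_cons, Multiset.map_cons, Multiset.prod_cons, ← hVS,
        ← this]
      ring

/-- Dividing `P` by `∏ (expPi z - expPi α)` over its roots in the open strip `|Re α| < 1` gives a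
function that is holomorphic on the closed strip and has no zeros in the open one. -/
lemma exists_weight {P : ℂ[X]} (hP : P ≠ 0) :
    ∃ W : ℂ → ℂ, (∀ z : ℂ, |z.re| ≤ 1 → DifferentiableAt ℂ W z) ∧
      (∀ z : ℂ, |z.re| < 1 → W z ≠ 0) ∧
      ∀ z : ℂ, |z.re| ≤ 1 → W z *
        ((P.roots.filter fun α => |α.re| < 1).map fun α => expPi z - expPi α).prod =
          P.eval z := by
  set S := P.roots.filter fun α : ℂ => |α.re| < 1 with hS
  set T := P.roots.filter fun α : ℂ => ¬ |α.re| < 1 with hT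
  obtain ⟨V, hV, hV0, hVS⟩ := exists_differentiable_mul_prod_sub S
    fun α hα => (Multiset.mem_filter.1 hα).2
  set Q : ℂ[X] := C P.leadingCoeff * (T.map fun α => X - C α).prod with hQ
  have hPQ : ∀ z, P.eval z = Q.eval z * (S.map fun α => z - α).prod := fun z => by
    rw [hQ, eval_mul, eval_C, eval_multiset_prod, Multiset.map_map,
      (IsAlgClosed.splits P).eval_eq_prod_roots, ← Multiset.filter_add_not (fun α : ℂ => |α.re| < 1)
        P.roots, Multiset.map_add, Multiset.prod_add]
    simp only [Function.comp_def, eval_sub, eval_X, eval_C]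
    ring
  refine ⟨fun z => Q.eval z / V z, fun z hz => Q.differentiable.differentiableAt.div
    hV.differentiableAt (hV0 z hz), fun z hz => div_ne_zero ?_ (hV0 z hz.le), fun z hz => ?_⟩
  · rw [hQ, eval_mul, eval_C, eval_multiset_prod, Multiset.map_map]
    refine mul_ne_zero (leadingCoeff_ne_zero.2 hP) ?_
    rw [ne_eq, Multiset.prod_eq_zero_iff, Multiset.mem_map]
    rintro ⟨α, hα, h0⟩
    have hzα : z = α := by simpa [sub_eq_zero] using h0
    exact (Multiset.mem_filter.1 hα).2 (hzα ▸ hz)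
  · rw [← hVS, hPQ]
    have := hV0 z hz
    field_simp

lemma exists_forall_roots_abs_im_lt (P : ℂ[X]) : ∃ u : ℝ, ∀ α ∈ P.roots, |α.im| < u := by
  obtain ⟨u, hu⟩ := (P.roots.toFinset.image fun α => |α.im|).bddAbove
  refine ⟨u + 1, fun α hα => lt_of_le_of_lt (hu ?_) (lt_add_one u)⟩
  exact Finset.mem_coe.2 (Finset.mem_image_of_mem _ (Multiset.mem_toFinset.2 hα))

/-- A weight as in `exists_weight` is real of constant sign on the imaginary axis. -/
lemma exists_sign_of_weight {P : ℂ[X]} (hP0 : P ≠ 0) (hP : pconj P = P) {W : ℂ → ℂ}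
    (hd : ∀ z : ℂ, |z.re| ≤ 1 → DifferentiableAt ℂ W z) (hW0 : ∀ z : ℂ, |z.re| < 1 → W z ≠ 0)
    (hW : ∀ z : ℂ, |z.re| ≤ 1 → W z *
        ((P.roots.filter fun α => |α.re| < 1).map fun α => expPi z - expPi α).prod =
          P.eval z) :
    ∃ ε : ℝ, (ε = 1 ∨ ε = -1) ∧ ∀ t : ℝ, ∃ w : ℝ, 0 < w ∧ W (t * I) = (ε * w : ℝ) := by
  have hWc : Continuous fun t : ℝ => W (t * I) := by
    refine continuous_iff_continuousAt.2 fun y => ?_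
    exact ContinuousAt.comp (f := fun y : ℝ => (y * I : ℂ)) (hd _ (by simp)).continuousAt
      (by fun_prop)
  have hfin : {t : ℝ | P.eval (t * I) = 0}.Finite := by
    refine Set.Finite.of_finite_image (f := fun t : ℝ => (t * I : ℂ))
      (P.roots.toFinset.finite_toSet.subset ?_) (fun s _ t _ h => by simpa using h)
    rintro _ ⟨t, ht, rfl⟩
    simpa [hP0] using ht
  have him : (fun t : ℝ => (W (t * I)).im) = fun _ => 0 := by
    refine Continuous.ext_on (hfin.countable.dense_compl ℝ) (continuous_im.comp hWc)
      continuous_const fun t ht => ?_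
    have ht0 : P.eval (t * I) ≠ 0 := ht
    have h1 := hW (t * I) (by simp)
    have hD0 := right_ne_zero_of_mul (h1 ▸ ht0)
    have hPr : conj (P.eval (t * I)) = P.eval (t * I) := by
      conv_rhs => rw [← hP, eval_pconj]
      simp
    have hDr := conj_multiset_prod_map (map_filter_roots_of_pconj_eq hP)
      (f := fun α => expPi (t * I) - expPi α) (fun α => by
        rw [expPi_neg_conj, map_sub, expPi_mul_I, conj_ofReal])
    rw [← conj_eq_iff_im, eq_div_of_mul_eq hD0 h1, map_div₀, hPr, hDr]
  have hreal : ∀ t : ℝ, W (t * I) = ((W (t * I)).re : ℝ) := fun t =>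
    Complex.ext rfl (by simpa using congrFun him t)
  have hre0 : ∀ t : ℝ, (W (t * I)).re ≠ 0 := fun t h0 =>
    hW0 (t * I) (by simp) (by rw [hreal, h0, ofReal_zero])
  have hconst : (∀ t : ℝ, 0 < (W (t * I)).re) ∨ ∀ t : ℝ, (W (t * I)).re < 0 := by
    by_contra! h
    obtain ⟨⟨a, ha⟩, b, hb⟩ := h
    obtain ⟨c, hc⟩ := mem_range_of_exists_le_of_exists_ge (continuous_re.comp hWc)
      ⟨a, ha⟩ ⟨b, hb⟩
    exact hre0 c hc
  rcases hconst with h | h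
  · exact ⟨1, Or.inl rfl, fun t => ⟨_, h t, by rw [one_mul]; exact hreal t⟩⟩
  · exact ⟨-1, Or.inr rfl, fun t => ⟨_, neg_pos.2 (h t), by
      rw [neg_one_mul, neg_neg]; exact hreal t⟩⟩

/-- A weight as in `exists_weight` takes a positive value on the imaginary axis if `P` is positive
near the ends of the axis. -/
lemma exists_weight_eq_pos {P : ℂ[X]} (hP : pconj P = P) {W : ℂ → ℂ}
    (hW : ∀ z : ℂ, |z.re| ≤ 1 → W z *
        ((P.roots.filter fun α => |α.re| < 1).map fun α => expPi z - expPi α).prod =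
          P.eval z) {m : ℕ} (hm : P.natDegree = 2 * m) {r : ℝ} (hr : 0 < r)
    (hlc : P.leadingCoeff = (-1 : ℂ) ^ m * (r : ℂ)) :
    ∃ t w : ℝ, 0 < w ∧ W (t * I) = w := by
  obtain ⟨u, hu⟩ := exists_forall_roots_abs_im_lt P
  have hroots : P.roots.map (fun α => -conj α) = P.roots := by rw [← roots_pconj, hP]
  obtain ⟨p, hp, hpe⟩ := exists_pos_multiset_prod_map hroots (f := fun α => u - I * α)
    (fun α => by simp) (fun α hα => by
      refine mem_slitPlane_iff.2 (Or.inl ?_)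
      have := (abs_lt.1 (hu α hα)).1
      simp
      linarith)
  obtain ⟨d, hd, hde⟩ := exists_pos_multiset_prod_map (map_filter_roots_of_pconj_eq hP)
    (f := fun α => expPi ((-u : ℝ) * I) - expPi α) (fun α => by
      rw [expPi_neg_conj, map_sub, expPi_mul_I, conj_ofReal]) (fun α hα => by
      refine mem_slitPlane_iff.2 (Or.inl ?_)
      have := (abs_lt.1 (hu α (Multiset.mem_filter.1 hα).1)).1
      rw [expPi_mul_I, sub_re, ofReal_re, sub_pos]
      refine (re_le_norm _).trans_lt ?_
      rw [norm_expPi]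
      exact Real.exp_lt_exp.2 (neg_lt_neg (mul_lt_mul_of_pos_left this Real.pi_pos)))
  have hPe : P.eval ((-u : ℝ) * I) = (r * p : ℝ) := by
    have hfac : P.roots.map (fun α => ((-u : ℝ) * I : ℂ) - α) =
        P.roots.map fun α => -I * (u - I * α) :=
      Multiset.map_congr rfl fun α _ => by
        push_cast
        linear_combination (-α) * I_mul_I
    rw [(IsAlgClosed.splits P).eval_eq_prod_roots, hfac, Multiset.prod_map_mul, hpe,
      Multiset.map_const', Multiset.prod_replicate,
      ← (IsAlgClosed.splits P).natDegree_eq_card_roots, hm, hlc, pow_mul, neg_sq, I_sq]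
    have hone : (-1 : ℂ) ^ m * (-1) ^ m = 1 := by rw [← mul_pow]; simp
    push_cast
    linear_combination (r * p : ℂ) * hone
  refine ⟨-u, r * p / d, by positivity, ?_⟩
  have h1 := hW ((-u : ℝ) * I) (by simp)
  rw [hde, hPe] at h1
  have hd0 : (d : ℂ) ≠ 0 := ofReal_ne_zero.2 hd.ne'
  rw [eq_div_of_mul_eq hd0 h1, ofReal_div]

/-- The sign pattern on the two edges of the strip of the weight `ε (expPi z) ^ j * W z`. -/
lemma exists_weight_left_edge {P : ℂ[X]} (hP : pconj P = P) {W : ℂ → ℂ}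
    (hW : ∀ z : ℂ, |z.re| ≤ 1 → W z *
        ((P.roots.filter fun α => |α.re| < 1).map fun α => expPi z - expPi α).prod =
          P.eval z) {ε : ℝ} {j : ℕ}
    (hj : ε * (-1) ^ j * (-1) ^ (P.roots.filter fun α => |α.re| < 1).card = -1) (t : ℝ) :
    ∃ q : ℝ, 0 < q ∧ ε * expPi (-1 + t * I) ^ j * W (-1 + t * I) =
      (-q : ℝ) * P.eval (-1 + t * I) := by
  set S := P.roots.filter fun α : ℂ => |α.re| < 1 with hS
  set y : ℝ := Real.exp (-(Real.pi * t)) with hy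
  have hy0 : 0 < y := Real.exp_pos _
  obtain ⟨d, hd, hde⟩ := exists_pos_multiset_prod_map (map_filter_roots_of_pconj_eq hP)
    (f := fun α => y + expPi α) (fun α => by rw [expPi_neg_conj, map_add, conj_ofReal])
    (fun α hα => add_expPi_mem_slitPlane hy0 (Multiset.mem_filter.1 hα).2)
  have hz : expPi (-1 + t * I) = -y := expPi_neg_one_add_mul_I t
  have hD : (S.map fun α => expPi (-1 + t * I) - expPi α).prod = (-1) ^ S.card * d := by
    rw [← hde, ← Multiset.prod_replicate, ← Multiset.map_const', ← Multiset.prod_map_mul, hz]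
    congr 1
    exact Multiset.map_congr rfl fun α _ => by ring
  have h1 := hW (-1 + t * I) (by simp)
  have hjc : (ε : ℂ) * (-1) ^ j * (-1) ^ S.card = -1 := by exact_mod_cast congrArg ofReal hj
  have hone : ((-1 : ℂ) ^ S.card) * (-1) ^ S.card = 1 := by rw [← mul_pow]; simp
  have hd0 : (d : ℂ) ≠ 0 := ofReal_ne_zero.2 hd.ne'
  refine ⟨y ^ j / d, by positivity, ?_⟩
  rw [← h1, hD, hz, neg_pow]
  push_cast
  field_simp
  linear_combination y ^ j * W (-1 + t * I) * (-1) ^ S.card * hjc -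
    ε * (-1) ^ j * y ^ j * W (-1 + t * I) * hone

/-- A polynomial `F` with `F(x) = -F̄(-x)` for which `F P` has zero real part on the line
`Re x = -1` vanishes, provided that `P` has a root. -/
lemma eq_zero_of_re_eq_zero {P F : ℂ[X]} (hP0 : P ≠ 0) (hP : pconj P = P) {α : ℂ}
    (hα : P.eval α = 0) (hF : ∀ t : ℝ, (F.eval (t * I)).re = 0)
    (hFP : ∀ t : ℝ, (F.eval (-1 + t * I) * P.eval (-1 + t * I)).re = 0) : F = 0 := by
  have hinf : (Set.range fun t : ℝ => (t * I : ℂ)).Infinite :=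
    Set.infinite_range_of_injective fun s t h => by simpa using h
  have hFc : pconj F = -F := by
    refine eq_of_infinite_eval_eq _ _ (hinf.mono ?_)
    rintro _ ⟨t, rfl⟩
    change (pconj F).eval (t * I) = (-F).eval (t * I)
    have h : -conj (t * I : ℂ) = t * I := by simp
    rw [eval_pconj, h, eval_neg]
    exact Complex.ext (by simp [hF t]) (by simp)
  have hper : (F * P).comp (X + 1) = (F * P).comp (X - 1) := by
    refine eq_of_infinite_eval_eq _ _ (hinf.mono ?_)
    rintro _ ⟨t, rfl⟩
    change ((F * P).comp (X + 1)).eval (t * I) = ((F * P).comp (X - 1)).eval (t * I)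
    simp only [eval_comp, eval_add, eval_sub, eval_X, eval_one, eval_mul]
    have h : -conj (t * I + 1 : ℂ) = t * I - 1 := by simp; ring
    have h1 : F.eval (t * I + 1) = -conj (F.eval (t * I - 1)) := by
      rw [← h, ← eval_pconj, hFc, eval_neg, neg_neg]
    have h2 : P.eval (t * I + 1) = conj (P.eval (t * I - 1)) := by
      rw [← h, ← eval_pconj, hP]
    rw [h1, h2, neg_mul, ← map_mul]
    have h3 := hFP t
    rw [neg_add_eq_sub] at h3
    exact Complex.ext (by rw [neg_re, conj_re, h3, neg_zero]) (by rw [neg_im, conj_im, neg_neg])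
  have hroot : ∀ n : ℕ, (F * P).eval (α + 2 * n) = 0 := by
    intro n
    induction n with
    | zero => simp [hα]
    | succ n ih =>
      have := congrArg (eval (α + 2 * n + 1)) hper
      simp only [eval_comp, eval_add, eval_sub, eval_X, eval_one, add_sub_cancel_right, ih] at this
      rw [← this]
      congr 1
      push_cast
      ring
  have hzero : F * P = 0 := by
    refine eq_zero_of_infinite_isRoot _ ((Set.infinite_range_of_injective
      (f := fun n : ℕ => α + 2 * (n : ℂ)) fun a b h => by simpa using h).mono ?_)
    rintro _ ⟨n, rfl⟩
    exact hroot n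
  exact (mul_eq_zero.1 hzero).resolve_right hP0
/-- suppose `P(x) = P̄(−x)` and either `P` has at least three roots (with
multiplicity) with `|Re α| < 1`, or `P` has at least two such roots, even degree `2m`, and
leading coefficient a real number of sign `(−1)^m`. Then there is no nonzero `F ∈ ℂ[x]` with
`Re F(x) ≥ 0` and `Re (F(x−1)P(x−1)) ≥ 0` on the imaginary axis. -/
theorem stmt8 (P : ℂ[X]) (hP : pconj P = P)
    (hcase : 3 ≤ (P.roots.filter (fun z => |z.re| < 1)).card ∨
      (2 ≤ (P.roots.filter (fun z => |z.re| < 1)).card ∧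
        ∃ m : ℕ, P.natDegree = 2 * m ∧
          ∃ r : ℝ, 0 < r ∧ P.leadingCoeff = (-1 : ℂ) ^ m * (r : ℂ))) :
    ¬ ∃ F : ℂ[X], F ≠ 0 ∧ (∀ x : ℂ, x.re = 0 → 0 ≤ (F.eval x).re) ∧
      (∀ x : ℂ, x.re = 0 → 0 ≤ (F.eval (x - 1) * P.eval (x - 1)).re) := by
  rintro ⟨F, hF0, hF, hFP⟩
  set S := P.roots.filter fun z : ℂ => |z.re| < 1 with hS
  have hS2 : 2 ≤ S.card := hcase.elim (fun h => by omega) fun h => h.1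
  obtain ⟨α, hα⟩ := Multiset.card_pos_iff_exists_mem.1 (by omega : 0 < S.card)
  have hαP := (Multiset.mem_filter.1 hα).1
  have hP0 : P ≠ 0 := ne_zero_of_mem_roots hαP
  obtain ⟨W, hWd, hW0, hW⟩ := exists_weight hP0
  obtain ⟨ε, hε, hεW⟩ := exists_sign_of_weight hP0 hP hWd hW0 hW
  have hεε : ε * ε = 1 := by rcases hε with rfl | rfl <;> norm_num
  obtain ⟨j, hj1, hjS, hj⟩ : ∃ j, 1 ≤ j ∧ j < S.card ∧ ε * (-1) ^ j * (-1) ^ S.card = -1 := by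
    by_cases hS3 : 3 ≤ S.card
    · rcases neg_one_pow_eq_or ℝ S.card with h | h <;> rcases hε with rfl | rfl
      · exact ⟨1, by omega, by omega, by rw [h]; norm_num⟩
      · exact ⟨2, by omega, by omega, by rw [h]; norm_num⟩
      · exact ⟨2, by omega, by omega, by rw [h]; norm_num⟩
      · exact ⟨1, by omega, by omega, by rw [h]; norm_num⟩
    · obtain ⟨-, m, hm, r, hr, hlc⟩ := hcase.resolve_left hS3
      have hcard : S.card = 2 := by omega
      refine ⟨1, le_rfl, by omega, ?_⟩
      obtain ⟨t, w, hw, htw⟩ := exists_weight_eq_pos hP hW hm hr hlc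
      obtain ⟨w', hw', htw'⟩ := hεW t
      rcases hε with rfl | rfl
      · rw [hcard]; norm_num
      · rw [htw, ofReal_inj] at htw'
        linarith
  set H : ℂ → ℂ := fun z => F.eval z * (ε * expPi z ^ j * W z) with hH
  have hright : ∀ t : ℝ, ∃ w : ℝ, 0 < w ∧ (H (t * I)).re = (F.eval (t * I)).re * w := by
    intro t
    obtain ⟨w, hw, htw⟩ := hεW t
    refine ⟨Real.exp (-(Real.pi * t)) ^ j * w, by positivity, ?_⟩
    rw [← re_mul_ofReal]
    congr 1
    have hεc : (ε : ℂ) * ε = 1 := by exact_mod_cast hεε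
    simp only [hH, htw, expPi_mul_I]
    push_cast
    linear_combination F.eval (t * I : ℂ) * exp (-(Real.pi * t)) ^ j * w * hεc
  have hleft : ∀ t : ℝ, ∃ q : ℝ, 0 < q ∧
      (H (-1 + t * I)).re = (F.eval (-1 + t * I) * P.eval (-1 + t * I)).re * -q := by
    intro t
    obtain ⟨q, hq, htq⟩ := exists_weight_left_edge hP hW hj t
    refine ⟨q, hq, ?_⟩
    rw [← re_mul_ofReal]
    congr 1
    simp only [hH, htq]
    ring
  have hlim : Tendsto H (comap (fun z => |z.im|) atTop ⊓ 𝓟 {z | |z.re| ≤ 1}) (𝓝 0) := by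
    have h0 := (tendsto_eval_mul_expPi_pow_div (F * P) hj1 hjS).const_mul (ε : ℂ)
    rw [mul_zero] at h0
    refine h0.congr' ?_
    obtain ⟨u, hu⟩ := exists_forall_roots_abs_im_lt P
    filter_upwards [mem_inf_of_left (preimage_mem_comap (Ici_mem_atTop u)),
      mem_inf_of_right (mem_principal_self _)] with z hzu hz
    have hPz : P.eval z ≠ 0 := fun h =>
      (hu z ((mem_roots hP0).2 h)).not_ge hzu
    have hWz : W z * (S.map fun α => expPi z - expPi α).prod = P.eval z := hW z hz
    have hD0 := right_ne_zero_of_mul (hWz ▸ hPz)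
    rw [eval_mul, ← hWz]
    simp only [hH]
    field_simp
  have hre := re_eq_zero_of_strip (f := H) (fun z h1 h2 => by
      have hWz := hWd z (abs_le.2 ⟨h1, h2.trans zero_le_one⟩)
      have := F.differentiable z
      have := differentiable_expPi z
      fun_prop)
    (fun t => by
      obtain ⟨w, hw, h⟩ := hright t
      rw [h]
      exact mul_nonneg (hF _ (by simp)) hw.le)
    (fun t => by
      obtain ⟨q, hq, h⟩ := hleft t
      have := hFP (t * I) (by simp)
      rw [← neg_add_eq_sub] at this
      rw [h]
      nlinarith) hlim
  refine hF0 (eq_zero_of_re_eq_zero hP0 hP ((mem_roots hP0).1 hαP) (fun t => ?_) fun t => ?_)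
  · obtain ⟨w, hw, h⟩ := hright t
    exact (mul_eq_zero.1 (h.symm.trans (hre t).1)).resolve_right hw.ne'
  · obtain ⟨q, hq, h⟩ := hleft t
    exact (mul_eq_zero.1 (h.symm.trans (hre t).2)).resolve_right (neg_ne_zero.2 hq.ne')

end
end

section
/- Let P ∈ ℂ[x] be a polynomial of degree n ≥ 1. Then every nonzero two-sided ideal of 𝒜(P) has finite codimension as a ℂ-vector subspace of 𝒜(P). -/
open Polynomial
open scoped Classical

noncomputable section

section WeightDecomposition

variable {A : Type*} [Ring A] [Algebra ℂ A]

theorem aeval_mul_of_commutator {h x : A} {c : ℂ} (hx : h * x - x * h = c • x) (S : ℂ[X]) :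
    aeval h S * x = x * aeval h (S.comp (X + C c)) := by
  have hx' : h * x = x * (h + algebraMap ℂ A c) := by
    rw [mul_add, ← Algebra.commutes, ← Algebra.smul_def, ← hx]; abel
  induction S using Polynomial.induction_on' with
  | add p q hp hq => simp only [map_add, add_comp, add_mul, mul_add, hp, hq]
  | monomial n a =>
    have hpow : h ^ n * x = x * (h + algebraMap ℂ A c) ^ n := by
      induction n with
      | zero => simp
      | succ n ih => rw [pow_succ, mul_assoc, hx', ← mul_assoc, ih, mul_assoc, ← pow_succ]
    simp only [aeval_monomial, monomial_comp, map_mul, aeval_C, map_pow, map_add, aeval_X]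
    rw [mul_assoc, hpow, ← mul_assoc, Algebra.commutes, mul_assoc]

theorem mul_aeval_of_commutator {h x : A} {c : ℂ} (hx : h * x - x * h = c • x) (S : ℂ[X]) :
    x * aeval h S = aeval h (S.comp (X - C c)) * x := by
  rw [aeval_mul_of_commutator hx, comp_assoc]
  simp

theorem commutator_pow {h x : A} {c : ℂ} (hx : h * x - x * h = c • x) (n : ℕ) :
    h * x ^ n - x ^ n * h = ((n : ℂ) * c) • x ^ n := by
  induction n with
  | zero => simp
  | succ n ih =>
    have : h * x ^ (n + 1) - x ^ (n + 1) * h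
        = (h * x ^ n - x ^ n * h) * x + x ^ n * (h * x - x * h) := by
      rw [pow_succ]; noncomm_ring
    rw [this, ih, hx, smul_mul_assoc, mul_smul_comm, ← pow_succ, ← add_smul]
    push_cast
    ring_nf

theorem exists_pow_mul_pow_eq_aeval {h x y : A} {c : ℂ} (hx : h * x - x * h = c • x)
    {Q : ℂ[X]} (hQ : Q ≠ 0) (hxy : x * y = aeval h Q) (n : ℕ) :
    ∃ T : ℂ[X], T ≠ 0 ∧ x ^ n * y ^ n = aeval h T := by
  induction n with
  | zero => exact ⟨1, one_ne_zero, by simp⟩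
  | succ n ih =>
    obtain ⟨T, hT, hT'⟩ := ih
    refine ⟨Q.comp (X - C ((n : ℂ) * c)) * T, mul_ne_zero ?_ hT, ?_⟩
    · rw [sub_eq_add_neg, ← C_neg]
      exact (comp_X_add_C_ne_zero_iff).2 hQ
    · rw [map_mul, ← hT', ← mul_assoc, ← mul_aeval_of_commutator (commutator_pow hx n), ← hxy,
        pow_succ, pow_succ']
      simp only [mul_assoc]

theorem isCoprime_comp_X_add_C {R : ℂ[X]} {c : ℂ}
    (hc : ∀ a ∈ R.roots.toFinset, ∀ b ∈ R.roots.toFinset, c ≠ a - b) (hR : R ≠ 0) :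
    IsCoprime R (R.comp (X + C c)) := by
  rw [isCoprime_iff_aeval_ne_zero_of_isAlgClosed ℂ ℂ]
  intro a
  by_contra! hcon
  obtain ⟨h1, h2⟩ := hcon
  refine hc (a + c) ?_ a ?_ (by ring)
  · simpa [hR] using h2
  · simpa [hR] using h1

/-- The generator of weight `2k`: a power of `e` if `k ≥ 0`, a power of `f` if `k ≤ 0`. -/
def weightGen (e f : A) : ℤ → A
  | Int.ofNat n => e ^ n
  | Int.negSucc n => f ^ (n + 1)

/-- The span `ℂ[h] · x`. -/
def polySpan (h x : A) : Submodule ℂ A :=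
  LinearMap.range ((LinearMap.mulRight ℂ x) ∘ₗ (aeval h : ℂ[X] →ₐ[ℂ] A).toLinearMap)

theorem mem_polySpan {h x a : A} : a ∈ polySpan h x ↔ ∃ S : ℂ[X], aeval h S * x = a := by
  simp [polySpan]

variable {e f h : A}

theorem commutator_weightGen (he : h * e - e * h = (2 : ℂ) • e)
    (hf : h * f - f * h = (-2 : ℂ) • f) (k : ℤ) :
    h * weightGen e f k - weightGen e f k * h = (2 * (k : ℂ)) • weightGen e f k := by
  cases k with
  | ofNat n =>
    rw [weightGen, commutator_pow he]
    congr 1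
    simp [mul_comm]
  | negSucc n =>
    rw [weightGen, commutator_pow hf]
    congr 1
    push_cast
    ring

theorem commutator_of_mem_polySpan (he : h * e - e * h = (2 : ℂ) • e)
    (hf : h * f - f * h = (-2 : ℂ) • f) {k : ℤ} {a : A}
    (ha : a ∈ polySpan h (weightGen e f k)) : h * a - a * h = (2 * (k : ℂ)) • a := by
  obtain ⟨S, rfl⟩ := mem_polySpan.1 ha
  have hc : h * aeval h S = aeval h S * h := by
    simpa using congrArg (aeval h) (mul_comm X S)
  rw [← mul_assoc, hc, mul_assoc, mul_assoc, ← mul_sub, commutator_weightGen he hf,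
    mul_smul_comm]

theorem e_mul_mem_polySpan (he : h * e - e * h = (2 : ℂ) • e) {Q : ℂ[X]}
    (hef : e * f = aeval h Q) {k : ℤ} {a : A} (ha : a ∈ polySpan h (weightGen e f k)) :
    e * a ∈ polySpan h (weightGen e f (k + 1)) := by
  obtain ⟨S, rfl⟩ := mem_polySpan.1 ha
  rw [← mul_assoc, mul_aeval_of_commutator he, mul_assoc, mem_polySpan]
  rcases k with n | n
  · exact ⟨_, congrArg _ (pow_succ' e n)⟩
  · refine ⟨S.comp (X - C 2) * Q, ?_⟩
    rw [map_mul, mul_assoc, ← hef, weightGen, pow_succ', ← mul_assoc e]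
    congr 2
    cases n with
    | zero => simp [weightGen]
    | succ n => rfl

theorem f_mul_mem_polySpan (hf : h * f - f * h = (-2 : ℂ) • f) {Q : ℂ[X]}
    (hfe : f * e = aeval h Q) {k : ℤ} {a : A} (ha : a ∈ polySpan h (weightGen e f k)) :
    f * a ∈ polySpan h (weightGen e f (k - 1)) := by
  obtain ⟨S, rfl⟩ := mem_polySpan.1 ha
  rw [← mul_assoc, mul_aeval_of_commutator hf, mul_assoc, mem_polySpan]
  rcases k with (_ | n) | n
  · refine ⟨S.comp (X - C (-2)), congrArg _ ?_⟩
    change f ^ (0 + 1) = f * e ^ 0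
    simp
  · refine ⟨S.comp (X - C (-2)) * Q, ?_⟩
    rw [map_mul, mul_assoc, ← hfe, show Int.ofNat (n + 1) - 1 = Int.ofNat n by simp, weightGen,
      weightGen, pow_succ', ← mul_assoc f]
  · exact ⟨_, congrArg _ (pow_succ' f (n + 1))⟩

theorem h_mul_mem_polySpan {x a : A} (ha : a ∈ polySpan h x) : h * a ∈ polySpan h x := by
  obtain ⟨S, rfl⟩ := mem_polySpan.1 ha
  exact mem_polySpan.2 ⟨X * S, by rw [map_mul, aeval_X, mul_assoc]⟩

theorem iSup_polySpan_eq_top (he : h * e - e * h = (2 : ℂ) • e)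
    (hf : h * f - f * h = (-2 : ℂ) • f) {Q Q' : ℂ[X]} (hef : e * f = aeval h Q)
    (hfe : f * e = aeval h Q') (hgen : Algebra.adjoin ℂ {e, f, h} = ⊤) :
    ⨆ k, polySpan h (weightGen e f k) = ⊤ := by
  set M := ⨆ k, polySpan h (weightGen e f k) with hM
  have hle (k : ℤ) : polySpan h (weightGen e f k) ≤ M :=
    le_iSup (fun k => polySpan h (weightGen e f k)) k
  have hmul {y : A} (hy : ∀ k, ∀ a ∈ polySpan h (weightGen e f k), y * a ∈ M) :
      ∀ a ∈ M, y * a ∈ M := by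
    have : M ≤ M.comap (LinearMap.mulLeft ℂ y) := iSup_le fun k a ha => hy k a ha
    exact this
  have hone : (1 : A) ∈ M := hle 0 (mem_polySpan.2 ⟨1, by simp [weightGen]⟩)
  refine eq_top_iff.2 fun a _ => ?_
  suffices ∀ m ∈ M, a * m ∈ M by simpa using this 1 hone
  have ha : a ∈ Algebra.adjoin ℂ {e, f, h} := hgen ▸ Algebra.mem_top
  induction ha using Algebra.adjoin_induction with
  | mem x hx =>
    rcases hx with rfl | rfl | rfl
    · exact hmul fun k a ha => hle _ (e_mul_mem_polySpan he hef ha)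
    · exact hmul fun k a ha => hle _ (f_mul_mem_polySpan hf hfe ha)
    · exact hmul fun k a ha => hle _ (h_mul_mem_polySpan ha)
  | algebraMap r =>
    intro m hm
    rw [← Algebra.smul_def]
    exact M.smul_mem r hm
  | add x y _ _ hx hy =>
    intro m hm
    rw [add_mul]
    exact M.add_mem (hx trivial m hm) (hy trivial m hm)
  | mul x y _ _ hx hy =>
    intro m hm
    rw [mul_assoc]
    exact hx trivial _ (hy trivial m hm)

/-- A subspace stable under `ad h` contains the weight components of its elements. -/
theorem mem_of_sum_mem {J : Submodule ℂ A} (hJ : ∀ a ∈ J, h * a - a * h ∈ J) (s : Finset ℤ)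
    (a : ℤ → A) (ha : ∀ k ∈ s, h * a k - a k * h = (2 * (k : ℂ)) • a k)
    (hs : ∑ k ∈ s, a k ∈ J) : ∀ k ∈ s, a k ∈ J := by
  induction s using Finset.induction_on generalizing a with
  | empty => simp
  | insert j s hj ih =>
    have hrest : ∀ k ∈ s, a k ∈ J := by
      intro k hk
      have hmem := ih (fun k => (2 * (k : ℂ) - 2 * (j : ℂ)) • a k) ?_ ?_ k hk
      · refine (J.smul_mem_iff ?_).1 hmem
        rw [← mul_sub, ← Int.cast_sub]
        refine mul_ne_zero two_ne_zero (Int.cast_ne_zero.2 (sub_ne_zero.2 ?_))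
        rintro rfl
        exact hj hk
      · intro k hk
        rw [mul_smul_comm, smul_mul_assoc, ← smul_sub, ha k (Finset.mem_insert_of_mem hk),
          smul_comm]
      · have := J.sub_mem (hJ _ hs) (J.smul_mem (2 * (j : ℂ)) hs)
        rw [Finset.mul_sum, Finset.sum_mul, ← Finset.sum_sub_distrib, Finset.smul_sum,
          ← Finset.sum_sub_distrib, Finset.sum_insert hj, ha j (Finset.mem_insert_self j s),
          sub_self, zero_add] at this
        convert this using 1
        refine Finset.sum_congr rfl fun k hk => ?_
        rw [ha k (Finset.mem_insert_of_mem hk), sub_smul]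
    intro k hk
    rcases Finset.mem_insert.1 hk with rfl | hk
    · rw [Finset.sum_insert hj] at hs
      exact (J.add_mem_iff_left (J.sum_mem hrest)).1 hs
    · exact hrest k hk

theorem exists_aeval_mem (he : h * e - e * h = (2 : ℂ) • e)
    (hf : h * f - f * h = (-2 : ℂ) • f) {Q Q' : ℂ[X]} (hQ : Q ≠ 0) (hQ' : Q' ≠ 0)
    (hef : e * f = aeval h Q) (hfe : f * e = aeval h Q')
    (hgen : Algebra.adjoin ℂ {e, f, h} = ⊤) {I : Ideal A}
    (hright : ∀ a ∈ I, ∀ r : A, a * r ∈ I) (hI : I ≠ ⊥) :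
    ∃ R : ℂ[X], R ≠ 0 ∧ aeval h R ∈ I := by
  obtain ⟨a, haI, ha0⟩ := Submodule.exists_mem_ne_zero_of_ne_bot hI
  have hatop : a ∈ ⨆ k, polySpan h (weightGen e f k) := by
    rw [iSup_polySpan_eq_top he hf hef hfe hgen]
    trivial
  obtain ⟨b, hb, hsum⟩ := (Submodule.mem_iSup_iff_exists_finsupp _ _).1 hatop
  have hcomp : ∀ k ∈ b.support, b k ∈ I.restrictScalars ℂ := by
    refine mem_of_sum_mem (h := h) (fun a ha => I.sub_mem (I.mul_mem_left h ha) (hright a ha h))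
      b.support b (fun k _ => commutator_of_mem_polySpan he hf (hb k)) ?_
    have : a = ∑ k ∈ b.support, b k := hsum.symm
    exact this ▸ haI
  obtain ⟨k, hk⟩ : b.support.Nonempty := by
    rw [Finset.nonempty_iff_ne_empty]
    intro h0
    apply ha0
    rw [← hsum, Finsupp.sum, h0, Finset.sum_empty]
  obtain ⟨S, hS⟩ := mem_polySpan.1 (hb k)
  have hS0 : S ≠ 0 := by
    rintro rfl
    apply Finsupp.mem_support_iff.1 hk
    rw [← hS, map_zero, zero_mul]
  have hbI : aeval h S * weightGen e f k ∈ I := hS ▸ hcomp k hk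
  obtain ⟨y, T, hT, hyT⟩ : ∃ (y : A) (T : ℂ[X]), T ≠ 0 ∧ weightGen e f k * y = aeval h T := by
    rcases k with n | n
    · exact ⟨f ^ n, exists_pow_mul_pow_eq_aeval he hQ hef n⟩
    · exact ⟨e ^ (n + 1), exists_pow_mul_pow_eq_aeval hf hQ' hfe (n + 1)⟩
  refine ⟨S * T, mul_ne_zero hS0 hT, ?_⟩
  rw [map_mul, ← hyT, ← mul_assoc]
  exact hright _ hbI y

theorem finite_setOf_weightGen_notMem (he : h * e - e * h = (2 : ℂ) • e)
    (hf : h * f - f * h = (-2 : ℂ) • f) {I : Ideal A}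
    (hright : ∀ a ∈ I, ∀ r : A, a * r ∈ I) {R : ℂ[X]} (hR : R ≠ 0) (hRI : aeval h R ∈ I) :
    {k : ℤ | weightGen e f k ∉ I}.Finite := by
  have hinj : Function.Injective fun k : ℤ => 2 * (k : ℂ) := fun a b hab => by
    simpa using hab
  refine ((((R.roots.toFinset ×ˢ R.roots.toFinset).image fun p => p.1 - p.2).finite_toSet).preimage
    hinj.injOn).subset fun k hk => ?_
  by_contra hnot
  apply hk
  obtain ⟨a, b, hab⟩ := isCoprime_comp_X_add_C (R := R) (c := 2 * (k : ℂ))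
    (fun x hx y hy hxy => hnot (by
      simp only [Set.mem_preimage, Finset.mem_coe, Finset.mem_image, Finset.mem_product]
      exact ⟨(x, y), ⟨hx, hy⟩, hxy.symm⟩)) hR
  set u := weightGen e f k
  have h1 : u * (aeval h R * aeval h a) ∈ I := I.mul_mem_left _ (hright _ hRI _)
  have h2 : u * aeval h (R.comp (X + C (2 * (k : ℂ)))) * aeval h b ∈ I := by
    rw [← aeval_mul_of_commutator (commutator_weightGen he hf k)]
    exact hright _ (hright _ hRI _) _
  have h3 := I.add_mem h1 h2
  rwa [mul_assoc, ← mul_add, ← map_mul, ← map_mul, ← map_add, mul_comm R a,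
    mul_comm (R.comp _) b, hab, map_one, mul_one] at h3

theorem finiteDimensional_quotient_of_two_sided (he : h * e - e * h = (2 : ℂ) • e)
    (hf : h * f - f * h = (-2 : ℂ) • f) {Q Q' : ℂ[X]} (hQ : Q ≠ 0) (hQ' : Q' ≠ 0)
    (hef : e * f = aeval h Q) (hfe : f * e = aeval h Q')
    (hgen : Algebra.adjoin ℂ {e, f, h} = ⊤) {I : Ideal A}
    (hright : ∀ a ∈ I, ∀ r : A, a * r ∈ I) (hI : I ≠ ⊥) :
    FiniteDimensional ℂ (A ⧸ Submodule.restrictScalars ℂ I) := by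
  obtain ⟨R, hR, hRI⟩ := exists_aeval_mem he hf hQ hQ' hef hfe hgen hright hI
  have hfin := finite_setOf_weightGen_notMem he hf hright hR hRI
  let D (k : ℤ) : Submodule ℂ A := (degreeLT ℂ R.natDegree).map
    ((LinearMap.mulRight ℂ (weightGen e f k)) ∘ₗ (aeval h : ℂ[X] →ₐ[ℂ] A).toLinearMap)
  let V : Submodule ℂ A := ⨆ k ∈ hfin.toFinset, D k
  have hD (k : ℤ) : (D k).FG := by
    have : FiniteDimensional ℂ (degreeLT ℂ R.natDegree) :=
      (degreeLTEquiv ℂ R.natDegree).symm.finiteDimensional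
    exact (Module.Finite.iff_fg.1 this).map _
  have hV : V.FG := Submodule.fg_biSup _ _ fun k _ => hD k
  have htop : V ⊔ I.restrictScalars ℂ = ⊤ := by
    rw [eq_top_iff, ← iSup_polySpan_eq_top he hf hef hfe hgen]
    refine iSup_le fun k a ha => ?_
    obtain ⟨S, rfl⟩ := mem_polySpan.1 ha
    by_cases hk : weightGen e f k ∈ I
    · exact Submodule.mem_sup_right (I.mul_mem_left _ hk)
    · rw [← EuclideanDomain.mod_add_div S R, map_add, add_mul]
      refine Submodule.add_mem_sup ?_ ?_
      · refine le_iSup₂ (f := fun k (_ : k ∈ hfin.toFinset) => D k) k (by simpa using hk) ?_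
        refine ⟨S % R, mem_degreeLT.2 ?_, rfl⟩
        rw [← degree_eq_natDegree hR]
        exact EuclideanDomain.mod_lt S hR
      · rw [map_mul, mul_assoc]
        exact hright _ hRI _
  refine Module.finite_def.2 ?_
  have hmap : V.map (I.restrictScalars ℂ).mkQ = ⊤ := by
    rw [sup_comm, ← Submodule.map_mkQ_eq_top] at htop
    exact htop
  exact hmap ▸ hV.map _

end WeightDecomposition

theorem adjoin_generators_eq_top (P : ℂ[X]) :
    Algebra.adjoin ℂ {eA P, fA P, hA P} = ⊤ := by
  have hrange : Set.range (fun i => RingQuot.mkAlgHom ℂ (ARel P) (FreeAlgebra.ι ℂ i))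
      ⊆ {eA P, fA P, hA P} := by
    rintro _ ⟨i, rfl⟩
    fin_cases i
    · exact Or.inl rfl
    · exact Or.inr (Or.inl rfl)
    · exact Or.inr (Or.inr rfl)
  refine eq_top_iff.2 (le_trans ?_ (Algebra.adjoin_mono hrange))
  rw [Set.range_comp' (RingQuot.mkAlgHom ℂ (ARel P)) (FreeAlgebra.ι ℂ), ← AlgHom.map_adjoin,
    FreeAlgebra.adjoin_range_ι, Algebra.map_top]
  exact ((AlgHom.range_eq_top _).2 (RingQuot.mkAlgHom_surjective ℂ (ARel P))).ge

/-- every nonzero two-sided ideal of `𝒜(P)` has finite codimension as a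
`ℂ`-vector subspace. (A two-sided ideal is a left ideal that is also closed under right
multiplication.) -/
theorem stmt9 (P : ℂ[X]) (hdeg : 1 ≤ P.natDegree) (I : Ideal (AP P))
    (hright : ∀ a ∈ I, ∀ r : AP P, a * r ∈ I) (hI : I ≠ ⊥) :
    FiniteDimensional ℂ (AP P ⧸ Submodule.restrictScalars ℂ I) := by
  have hP : P ≠ 0 := fun h0 => by simp [h0] at hdeg
  have he := RingQuot.mkAlgHom_rel ℂ (ARel.he (P := P))
  have hf := RingQuot.mkAlgHom_rel ℂ (ARel.hf (P := P))
  have hef := RingQuot.mkAlgHom_rel ℂ (ARel.ef (P := P))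
  have hfe := RingQuot.mkAlgHom_rel ℂ (ARel.fe (P := P))
  simp only [map_sub, map_mul, map_neg, map_ofNat, ← aeval_algHom_apply, map_add, map_one]
    at he hf hef hfe
  refine finiteDimensional_quotient_of_two_sided (e := eA P) (f := fA P) (h := hA P)
    (Q := P.comp (X + C (-1))) (Q' := P.comp (X + C 1)) ?_ ?_ (comp_X_add_C_ne_zero_iff.2 hP)
    (comp_X_add_C_ne_zero_iff.2 hP) ?_ ?_ (adjoin_generators_eq_top P) hright hI
  · rw [Algebra.smul_def, map_ofNat]
    exact he
  · rw [Algebra.smul_def, map_neg, map_ofNat]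
    exact hf.trans (neg_mul 2 (fA P)).symm
  · rw [aeval_comp, C_neg, C_1, ← sub_eq_add_neg, map_sub, aeval_X, map_one]
    exact hef
  · rw [aeval_comp, C_1, map_add, aeval_X, map_one]
    exact hfe

end
end

section
/- Let F ∈ ℂ[x] be nonzero with F(it) real and ≥ 0 for every t ∈ ℝ, and let S ∈ ℂ[x] satisfy S(x+1) − S(x−1) = F(x) and S̄(−x) = −S(x) (such an S exists and is unique up to adding a purely imaginary constant). Then S(−α) − S(α) is a positive real number for every α ∈ (−1, 0), and S'(0) is a positive real number. -/
open Polynomial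
open scoped Classical

noncomputable section

/-- A polynomial grows at most like the exponential. -/
theorem exists_norm_eval_le_exp (P : ℂ[X]) :
    ∃ C : ℝ, 0 ≤ C ∧ ∀ z : ℂ, ‖P.eval z‖ ≤ C * Real.exp ‖z‖ := by
  induction P using Polynomial.induction_on' with
  | add p q hp hq =>
    obtain ⟨C, hC, hp⟩ := hp
    obtain ⟨D, hD, hq⟩ := hq
    refine ⟨C + D, by positivity, fun z => ?_⟩
    rw [eval_add, add_mul]
    exact (norm_add_le _ _).trans (add_le_add (hp z) (hq z))
  | monomial n a =>
    refine ⟨‖a‖ * n.factorial, by positivity, fun z => ?_⟩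
    rw [eval_monomial, norm_mul, norm_pow, mul_assoc]
    have h := Real.pow_div_factorial_le_exp ‖z‖ (norm_nonneg z) n
    rw [div_le_iff₀ (by positivity)] at h
    gcongr
    linarith

theorem exp_abs_im_le_norm_cos (w : ℂ) :
    (Real.exp |w.im| - Real.exp (-|w.im|)) / 2 ≤ ‖Complex.cos w‖ := by
  have h1 : ‖Complex.exp (w * Complex.I)‖ = Real.exp (-w.im) := by
    simp [Complex.norm_exp]
  have h2 : ‖Complex.exp (-w * Complex.I)‖ = Real.exp w.im := by
    simp [Complex.norm_exp]
  have h3 := norm_sub_norm_le (Complex.exp (w * Complex.I)) (-Complex.exp (-w * Complex.I))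
  have h4 := norm_sub_norm_le (Complex.exp (-w * Complex.I)) (-Complex.exp (w * Complex.I))
  rw [norm_neg, sub_neg_eq_add] at h3 h4
  rw [add_comm] at h4
  rw [h1, h2] at h3 h4
  rw [Complex.cos, norm_div, Complex.norm_two]
  rcases abs_cases w.im with ⟨h, -⟩ | ⟨h, -⟩ <;> rw [h] <;> try rw [neg_neg]
  all_goals linarith

theorem exp_le_norm_cos_sub_cos (b : ℝ) (z : ℂ) (hz : 1 ≤ |z.im|) :
    Real.exp (3 * |z.im|) / 4 ≤ ‖Complex.cos (Real.pi * b) - Complex.cos (Real.pi * z)‖ := by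
  have h1 := exp_abs_im_le_norm_cos (Real.pi * z)
  have h2 : ((Real.pi : ℂ) * z).im = Real.pi * z.im := by simp
  rw [h2, abs_mul, abs_of_pos Real.pi_pos] at h1
  have h3 : ‖Complex.cos ((Real.pi : ℂ) * b)‖ ≤ 1 := by
    rw [← Complex.ofReal_mul, ← Complex.ofReal_cos, Complex.norm_real]
    exact Real.abs_cos_le_one _
  have h4 : Real.exp (3 * |z.im|) ≤ Real.exp (Real.pi * |z.im|) := by
    gcongr
    exact Real.pi_gt_three.le
  have h5 : Real.exp (-(Real.pi * |z.im|)) ≤ 1 := by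
    rw [Real.exp_le_one_iff]
    have := Real.pi_pos
    nlinarith
  have h6 : 8 ≤ Real.exp (3 * |z.im|) := by
    have h : Real.exp (3 * |z.im|) = Real.exp |z.im| ^ 3 := by
      rw [← Real.exp_nat_mul]; norm_num
    have h' : 2 ≤ Real.exp |z.im| := by linarith [Real.add_one_le_exp |z.im|]
    rw [h]
    calc (8 : ℝ) = 2 ^ 3 := by norm_num
      _ ≤ _ := by gcongr
  have h7 := norm_sub_norm_le (Complex.cos (Real.pi * z)) (Complex.cos (Real.pi * b))
  rw [norm_sub_rev] at h7
  linarith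

/-- The entire function `sin w / w`. -/
def csinc : ℂ → ℂ := dslope Complex.sin 0

theorem differentiable_csinc : Differentiable ℂ csinc := by
  rw [← differentiableOn_univ]
  exact (Complex.differentiableOn_dslope Filter.univ_mem).2 Complex.differentiable_sin.differentiableOn

theorem mul_csinc (w : ℂ) : w * csinc w = Complex.sin w := by
  simpa [csinc] using sub_smul_dslope Complex.sin 0 w

theorem csinc_ne_zero {w : ℂ} (hw : |w.re| < Real.pi) : csinc w ≠ 0 := by
  intro h
  have hs : Complex.sin w = 0 := by rw [← mul_csinc, h, mul_zero]
  obtain ⟨k, hk⟩ := Complex.sin_eq_zero_iff.1 hs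
  have hre : w.re = k * Real.pi := by rw [hk]; simp
  rw [hre, abs_mul, abs_of_pos Real.pi_pos] at hw
  have hk1 : |(k : ℝ)| < 1 := by
    by_contra! h1
    nlinarith [Real.pi_pos]
  have hk0 : k = 0 := by
    rw [← Int.abs_lt_one_iff]
    exact_mod_cast hk1
  rw [hk, hk0] at h
  simp [csinc] at h

/-- The quotient `(cos πb - cos πz) / (z² - b²)`, as an entire function of `z`. -/
def cosQuot (b : ℝ) (z : ℂ) : ℂ :=
  Real.pi ^ 2 / 2 * (csinc (Real.pi * (z - b) / 2) * csinc (Real.pi * (z + b) / 2))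

theorem differentiable_cosQuot (b : ℝ) : Differentiable ℂ (cosQuot b) := by
  unfold cosQuot
  have h1 : Differentiable ℂ fun z : ℂ => csinc (Real.pi * (z - b) / 2) :=
    differentiable_csinc.comp (by fun_prop)
  have h2 : Differentiable ℂ fun z : ℂ => csinc (Real.pi * (z + b) / 2) :=
    differentiable_csinc.comp (by fun_prop)
  exact (h1.mul h2).const_mul _

theorem mul_cosQuot (b : ℝ) (z : ℂ) :
    (z ^ 2 - b ^ 2) * cosQuot b z = Complex.cos (Real.pi * b) - Complex.cos (Real.pi * z) := by
  rw [Complex.cos_sub_cos]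
  have h1 := mul_csinc (Real.pi * (z - b) / 2)
  have h2 := mul_csinc (Real.pi * (z + b) / 2)
  have e1 : ((Real.pi : ℂ) * b + Real.pi * z) / 2 = Real.pi * (z + b) / 2 := by ring
  have e2 : ((Real.pi : ℂ) * b - Real.pi * z) / 2 = -(Real.pi * (z - b) / 2) := by ring
  rw [e1, e2, Complex.sin_neg, ← h1, ← h2, cosQuot]
  ring

theorem cosQuot_ne_zero {b : ℝ} (hb0 : 0 ≤ b) (hb1 : b < 1) {z : ℂ} (hz : |z.re| ≤ 1) :
    cosQuot b z ≠ 0 := by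
  obtain ⟨h1, h2⟩ := abs_le.1 hz
  have hpi := Real.pi_pos
  have e1 : ((Real.pi : ℂ) * (z - b) / 2).re = Real.pi * (z.re - b) / 2 := by simp
  have e2 : ((Real.pi : ℂ) * (z + b) / 2).re = Real.pi * (z.re + b) / 2 := by simp
  refine mul_ne_zero (by simp [hpi.ne']) (mul_ne_zero (csinc_ne_zero ?_) (csinc_ne_zero ?_))
  · rw [e1, abs_lt]; constructor <;> nlinarith
  · rw [e2, abs_lt]; constructor <;> nlinarith

open Filter Topology in
/-- Cauchy's theorem in the strip `|Re z| ≤ 1` for `Q(z) / cosQuot b z`. -/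
theorem tendsto_integral_div_cosQuot (Q : ℂ[X]) {b : ℝ} (hb0 : 0 ≤ b) (hb1 : b < 1) :
    Tendsto (fun T : ℝ => (∫ y in -T..T, Q.eval (1 + y * Complex.I) / cosQuot b (1 + y * Complex.I))
      - ∫ y in -T..T, Q.eval (-1 + y * Complex.I) / cosQuot b (-1 + y * Complex.I))
      atTop (𝓝 0) := by
  set G : ℂ → ℂ := fun z => Q.eval z / cosQuot b z with hG
  obtain ⟨C, hC, hbound⟩ := exists_norm_eval_le_exp ((X ^ 2 - C ((b : ℂ) ^ 2)) * Q)
  have hGbound : ∀ z : ℂ, |z.re| ≤ 1 → 1 ≤ |z.im| →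
      ‖G z‖ ≤ 4 * C * Real.exp 1 * Real.exp (-(2 * |z.im|)) := by
    intro z hz1 hz2
    have hW := exp_le_norm_cos_sub_cos b z hz2
    have hid : G z * (Complex.cos (Real.pi * b) - Complex.cos (Real.pi * z)) =
        ((X ^ 2 - Polynomial.C ((b : ℂ) ^ 2)) * Q).eval z := by
      rw [← mul_cosQuot, hG]
      have := cosQuot_ne_zero hb0 hb1 hz1
      simp only [eval_mul, eval_sub, eval_pow, eval_X, eval_C]
      field_simp
    have h1 := hbound z
    rw [← hid, norm_mul] at h1
    have h2 : ‖G z‖ * (Real.exp (3 * |z.im|) / 4) ≤ C * Real.exp (1 + |z.im|) := by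
      calc _ ≤ ‖G z‖ * ‖Complex.cos (Real.pi * b) - Complex.cos (Real.pi * z)‖ := by gcongr
        _ ≤ _ := h1
        _ ≤ _ := by
          gcongr
          exact (Complex.norm_le_abs_re_add_abs_im z).trans (by linarith)
    have h3 : Real.exp (3 * |z.im|) * Real.exp (-(3 * |z.im|)) = 1 := by
      rw [← Real.exp_add]; simp
    have h4 : Real.exp 1 * Real.exp (-(2 * |z.im|)) =
        Real.exp (1 + |z.im|) * Real.exp (-(3 * |z.im|)) := by
      rw [← Real.exp_add, ← Real.exp_add]; ring_nf
    calc ‖G z‖ = 4 * (‖G z‖ * (Real.exp (3 * |z.im|) / 4)) * Real.exp (-(3 * |z.im|)) := by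
          linear_combination (-‖G z‖) * h3
      _ ≤ 4 * (C * Real.exp (1 + |z.im|)) * Real.exp (-(3 * |z.im|)) := by gcongr
      _ = _ := by linear_combination (-4 * C) * h4
  have hcauchy : ∀ T : ℝ, 0 ≤ T → (∫ y in -T..T, G (1 + y * Complex.I))
      - (∫ y in -T..T, G (-1 + y * Complex.I)) =
      Complex.I * ((∫ x in (-1 : ℝ)..1, G (x + ((-T : ℝ) : ℂ) * Complex.I))
        - ∫ x in (-1 : ℝ)..1, G (x + (T : ℂ) * Complex.I)) := by
    intro T hT
    have h := Complex.integral_boundary_rect_eq_zero_of_differentiableOn G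
      (⟨-1, -T⟩ : ℂ) (⟨1, T⟩ : ℂ) ?_
    · simp only [smul_eq_mul, Complex.ofReal_one, Complex.ofReal_neg] at h ⊢
      linear_combination (-Complex.I) * h + ((∫ y in -T..T, G (1 + y * Complex.I))
        - (∫ y in -T..T, G (-1 + y * Complex.I))) * Complex.I_mul_I
    · intro z hz
      have hre : |z.re| ≤ 1 := by
        have := hz.1
        simpa [Set.uIcc_of_le, abs_le] using this
      exact (Q.differentiable.differentiableAt.div (differentiable_cosQuot b).differentiableAt
        (cosQuot_ne_zero hb0 hb1 hre)).differentiableWithinAt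
  have hzero : Tendsto (fun T : ℝ => 4 * (4 * C * Real.exp 1 * Real.exp (-(2 * T)))) atTop
      (𝓝 0) := by
    have h : Tendsto (fun T : ℝ => Real.exp (-(2 * T))) atTop (𝓝 0) :=
      Real.tendsto_exp_neg_atTop_nhds_zero.comp (tendsto_id.const_mul_atTop two_pos)
    simpa using (h.const_mul (4 * C * Real.exp 1)).const_mul 4
  refine squeeze_zero_norm' ?_ hzero
  filter_upwards [eventually_ge_atTop 1] with T hT
  have hT0 : |T| = T := abs_of_nonneg (by linarith)
  rw [hcauchy T (by linarith), norm_mul, Complex.norm_I, one_mul]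
  have hseg : ∀ s : ℝ, |s| = T → ‖∫ x in (-1 : ℝ)..1, G (x + (s : ℂ) * Complex.I)‖ ≤
      4 * C * Real.exp 1 * Real.exp (-(2 * T)) * |1 - (-1)| := by
    intro s hs
    refine intervalIntegral.norm_integral_le_of_norm_le_const fun x hx => ?_
    rw [Set.uIoc_of_le (by norm_num)] at hx
    have := hGbound (x + (s : ℂ) * Complex.I) (by simpa [abs_le] using ⟨hx.1.le, hx.2⟩)
      (by simpa [hs] using hT)
    simpa [hs] using this
  have h1 := hseg (-T) (by rw [abs_neg, hT0])
  have h2 := hseg T hT0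
  have h3 : |(1 : ℝ) - (-1)| = 2 := by norm_num
  rw [h3] at h1 h2
  exact (norm_sub_le _ _).trans (by linarith)

theorem cosQuot_add_mul_I (b y : ℝ) {e : ℂ} (he : e = 1 ∨ e = -1) :
    ((e + y * Complex.I) ^ 2 - b ^ 2) * cosQuot b (e + y * Complex.I) =
      ((Real.cos (Real.pi * b) + Real.cosh (Real.pi * y) : ℝ) : ℂ) := by
  have h : Complex.cos (Real.pi * (e + y * Complex.I)) = -Complex.cosh (Real.pi * y) := by
    rw [← Complex.cos_mul_I]
    rcases he with rfl | rfl
    · rw [← Complex.cos_add_pi]; ring_nf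
    · rw [← Complex.cos_sub_pi]; ring_nf
  rw [mul_cosQuot, h]
  push_cast
  ring

open Filter Topology in
/-- If `S` is `c + m x` modulo `x² - b²`, then `m > 0`. -/
theorem slope_pos (F S Q : ℂ[X]) (hF : F ≠ 0)
    (hFpos : ∀ t : ℝ, ∃ r : ℝ, 0 ≤ r ∧ F.eval (Complex.I * t) = (r : ℂ))
    (hS : S.comp (X + 1) - S.comp (X - 1) = F) {b : ℝ} (hb0 : 0 ≤ b) (hb1 : b < 1) (c m : ℂ)
    (hm : ∀ z, S.eval z = c + m * z + (z ^ 2 - b ^ 2) * Q.eval z) :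
    ∃ r : ℝ, 0 < r ∧ m = r := by
  set k : ℝ → ℝ := fun y => (Real.cos (Real.pi * b) + Real.cosh (Real.pi * y))⁻¹ with hk
  have hden : ∀ y : ℝ, 0 < Real.cos (Real.pi * b) + Real.cosh (Real.pi * y) := by
    intro y
    have h1 : Real.cos Real.pi < Real.cos (Real.pi * b) :=
      Real.cos_lt_cos_of_nonneg_of_le_pi (by positivity) le_rfl (by nlinarith [Real.pi_pos])
    rw [Real.cos_pi] at h1
    linarith [Real.one_le_cosh (Real.pi * y)]
  have hkpos : ∀ y, 0 < k y := fun y => inv_pos.2 (hden y)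
  have hkcont : Continuous k :=
    Continuous.inv₀ (by have := Real.continuous_cosh; fun_prop) fun y => (hden y).ne'
  choose f hf0 hf using hFpos
  have hfcont : Continuous f := by
    have : f = fun t : ℝ => (F.eval (Complex.I * t)).re := by
      funext t; rw [hf, Complex.ofReal_re]
    rw [this]
    exact Complex.continuous_re.comp (F.continuous.comp (by fun_prop))
  have hfne : ∃ t ∈ Set.Icc (-1 : ℝ) 1, f t ≠ 0 := by
    by_contra! h
    refine hF (F.eq_zero_of_infinite_isRoot ?_)
    have hinj : Function.Injective fun t : ℝ => Complex.I * (t : ℂ) := by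
      intro s t hst
      simpa using hst
    refine ((Set.Icc_infinite (by norm_num : (-1 : ℝ) < 1)).image hinj.injOn).mono ?_
    rintro _ ⟨t, ht, rfl⟩
    simp [IsRoot, hf, h t ht]
  have hfk : Continuous fun y => f y * k y := hfcont.mul hkcont
  have hA1 : 0 < ∫ y in (-1 : ℝ)..1, f y * k y := by
    obtain ⟨t, ht, htne⟩ := hfne
    exact intervalIntegral.integral_pos (by norm_num) hfk.continuousOn
      (fun y _ => mul_nonneg (hf0 y) (hkpos y).le)
      ⟨t, ht, mul_pos ((hf0 t).lt_of_ne' htne) (hkpos t)⟩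
  have hB1 : 0 < ∫ y in (-1 : ℝ)..1, k y :=
    intervalIntegral.integral_pos (by norm_num) hkcont.continuousOn (fun y _ => (hkpos y).le)
      ⟨0, by norm_num, hkpos 0⟩
  have hmono : ∀ g : ℝ → ℝ, Continuous g → (∀ y, 0 ≤ g y) → ∀ T : ℝ, 1 ≤ T →
      ∫ y in (-1 : ℝ)..1, g y ≤ ∫ y in -T..T, g y := fun g hg hg0 T hT =>
    intervalIntegral.integral_mono_interval (by linarith) (by norm_num) hT
      (Eventually.of_forall hg0) (hg.intervalIntegrable _ _)
  have hlim : Tendsto (fun T : ℝ => ((∫ y in -T..T, f y * k y : ℝ) : ℂ)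
      - 2 * m * ((∫ y in -T..T, k y : ℝ) : ℂ)) atTop (𝓝 0) := by
    refine (tendsto_integral_div_cosQuot Q hb0 hb1).congr fun T => ?_
    have hcont : ∀ e : ℂ, (e = 1 ∨ e = -1) → Continuous fun y : ℝ =>
        Q.eval (e + y * Complex.I) / cosQuot b (e + y * Complex.I) := by
      intro e he
      refine (Q.continuous.comp (by fun_prop)).div
        ((differentiable_cosQuot b).continuous.comp (by fun_prop)) fun y => ?_
      refine cosQuot_ne_zero hb0 hb1 ?_
      rcases he with rfl | rfl <;> simp
    have hfkc : Continuous fun y => ((f y * k y : ℝ) : ℂ) := Complex.continuous_ofReal.comp hfk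
    have hkc : Continuous fun y => 2 * m * (k y : ℂ) :=
      (Complex.continuous_ofReal.comp hkcont).const_mul _
    rw [← intervalIntegral.integral_sub ((hcont 1 (.inl rfl)).intervalIntegrable _ _)
      ((hcont (-1) (.inr rfl)).intervalIntegrable _ _), ← intervalIntegral.integral_ofReal,
      ← intervalIntegral.integral_ofReal, ← intervalIntegral.integral_const_mul,
      ← intervalIntegral.integral_sub (hfkc.intervalIntegrable _ _)
        (hkc.intervalIntegrable _ _)]
    refine intervalIntegral.integral_congr fun y _ => ?_
    have hquot : ∀ e : ℂ, (e = 1 ∨ e = -1) →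
        Q.eval (e + y * Complex.I) / cosQuot b (e + y * Complex.I) =
          ((e + y * Complex.I) ^ 2 - b ^ 2) * Q.eval (e + y * Complex.I) * (k y : ℂ) := by
      intro e he
      have h1 := cosQuot_add_mul_I b y he
      have h2 : ((Real.cos (Real.pi * b) + Real.cosh (Real.pi * y) : ℝ) : ℂ) ≠ 0 :=
        Complex.ofReal_ne_zero.2 (hden y).ne'
      have h3 : cosQuot b (e + y * Complex.I) ≠ 0 := by
        intro h; rw [h, mul_zero] at h1; exact h2 h1.symm
      rw [hk, Complex.ofReal_inv, ← div_eq_mul_inv, div_eq_div_iff h3 h2, ← h1]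
      ring
    have hFy : (f y : ℂ) = S.eval (1 + y * Complex.I) - S.eval (-1 + y * Complex.I) := by
      rw [← hf, ← hS]
      simp only [eval_sub, eval_comp, eval_add, eval_X, eval_one]
      ring_nf
    simp only [hquot 1 (.inl rfl), hquot (-1) (.inr rfl)]
    rw [Complex.ofReal_mul, hFy, hm, hm]
    ring
  have hre := (Complex.continuous_re.tendsto 0).comp hlim
  have him := (Complex.continuous_im.tendsto 0).comp hlim
  have ereq : ∀ A B : ℝ, ((A : ℂ) - 2 * m * (B : ℂ)).re = A - 2 * m.re * B := by
    intro A B; simp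
  have eieq : ∀ A B : ℝ, ((A : ℂ) - 2 * m * (B : ℂ)).im = -(2 * m.im * B) := by
    intro A B; simp
  simp only [Function.comp_def, ereq, eieq, Complex.zero_re, Complex.zero_im] at hre him
  refine ⟨m.re, ?_, Complex.ext rfl ?_⟩
  · by_contra! hneg
    refine absurd (ge_of_tendsto hre ?_) (not_le.2 hA1)
    filter_upwards [eventually_ge_atTop 1] with T hT
    have h1 := hmono _ hfk (fun y => mul_nonneg (hf0 y) (hkpos y).le) T hT
    have h2 := hmono _ hkcont (fun y => (hkpos y).le) T hT
    nlinarith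
  · by_contra hne
    rw [Complex.ofReal_im] at hne
    have h0 := him.abs
    rw [abs_zero] at h0
    have hpos : 0 < 2 * |m.im| * ∫ y in (-1 : ℝ)..1, k y := by positivity
    refine absurd (ge_of_tendsto h0 ?_) (not_le.2 hpos)
    filter_upwards [eventually_ge_atTop 1] with T hT
    have h2 := hmono _ hkcont (fun y => (hkpos y).le) T hT
    rw [abs_neg, abs_mul, abs_mul, abs_two]
    gcongr
    exact h2.trans (le_abs_self _)

/-- Division with remainder by `x² - a`. -/
theorem exists_eval_eq_linear_add (S : ℂ[X]) (a : ℂ) :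
    ∃ (Q : ℂ[X]) (c m : ℂ), S = C c + C m * X + (X ^ 2 - C a) * Q := by
  have hmonic : (X ^ 2 - C a : ℂ[X]).Monic := monic_X_pow_sub_C a two_ne_zero
  have hdeg : (S %ₘ (X ^ 2 - C a)).degree ≤ 1 := by
    have h := degree_modByMonic_lt S hmonic
    rw [degree_X_pow_sub_C two_pos] at h
    exact Order.lt_succ_iff.1 h
  have h := modByMonic_add_div S (X ^ 2 - C a)
  rw [eq_X_add_C_of_degree_le_one hdeg, add_comm (C _ * X)] at h
  exact ⟨_, _, _, h.symm⟩

/-- if `F ≠ 0` is nonnegative on the imaginary axis and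
`S(x+1) − S(x−1) = F(x)` with `S̄(−x) = −S(x)`, then `S(−α) − S(α) > 0` for all
`α ∈ (−1, 0)` and `S'(0) > 0` (both values being real). -/
theorem stmt13 (F S : ℂ[X]) (hF : F ≠ 0)
    (hFpos : ∀ t : ℝ, ∃ r : ℝ, 0 ≤ r ∧ F.eval (Complex.I * t) = (r : ℂ))
    (hS : S.comp (X + 1) - S.comp (X - 1) = F)
    (hSodd : pconj S = -S) :
    (∀ α : ℝ, -1 < α → α < 0 →
      ∃ r : ℝ, 0 < r ∧ S.eval (-(α : ℂ)) - S.eval (α : ℂ) = (r : ℂ)) ∧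
    (∃ r : ℝ, 0 < r ∧ S.derivative.eval 0 = (r : ℂ)) := by
  refine ⟨fun α hα1 hα0 => ?_, ?_⟩
  · obtain ⟨Q, c, m, hQ⟩ := exists_eval_eq_linear_add S (((-α : ℝ) : ℂ) ^ 2)
    have hm : ∀ z, S.eval z = c + m * z + (z ^ 2 - ((-α : ℝ) : ℂ) ^ 2) * Q.eval z := by
      intro z
      conv_lhs => rw [hQ]
      simp
    obtain ⟨r, hr, rfl⟩ := slope_pos F S Q hF hFpos hS (by linarith) (by linarith) c m hm
    refine ⟨-2 * α * r, by nlinarith, ?_⟩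
    rw [hm, hm]
    push_cast
    ring
  · obtain ⟨Q, c, m, hQ⟩ := exists_eval_eq_linear_add S (((0 : ℝ) : ℂ) ^ 2)
    have hm : ∀ z, S.eval z = c + m * z + (z ^ 2 - ((0 : ℝ) : ℂ) ^ 2) * Q.eval z := by
      intro z
      conv_lhs => rw [hQ]
      simp
    obtain ⟨r, hr, rfl⟩ := slope_pos F S Q hF hFpos hS le_rfl one_pos c m hm
    refine ⟨r, hr, ?_⟩
    rw [hQ]
    simp

end
end
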